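/- arXiv:1904.04682 — 4 statements merged into one kernel-verified Lean document; each statement's English description precedes it below -/
import Mathlib

section
/- Let m ≥ 2 be an integer and let D = (V,E,w) be a vertex-weighted oriented m-partite graph of the second class (with m parts), having no isolated vertices. Assume w(x) = 1 for every source vertex of D and w(x) ≥ 2 for every non-source vertex x ∈ V \ (V_1 ⊔ V_m). Then depth(I(D)) = |V_1| + 2 if |V_1| < |V_2|, and depth(I(D)) = |V_2| + 1 if |V_1| = |V_2| (equivalently, depth(I(D)) = |V| − pd(I(D)) by the Auslander–Buchsbaum formula). -/
open MvPolynomial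

noncomputable section

namespace WOG

variable {k : Type} [Field k]

/-- The maximal graded ideal `(x : x ∈ V)` of the polynomial ring. -/
def mIdeal (k V : Type) [Field k] : Ideal (MvPolynomial V k) :=
  Ideal.span (Set.range (X : V → MvPolynomial V k))

/-- The edge ideal `I(D) = (x * y^{w(y)} : (x,y) ∈ E)` of a vertex-weighted
oriented graph `D = (V, E, w)`. -/
def edgeIdeal (k : Type) [Field k] {V : Type} (E : Set (V × V)) (w : V → ℕ) :
    Ideal (MvPolynomial V k) :=
  Ideal.span {p : MvPolynomial V k | ∃ e ∈ E, p = X e.1 * X e.2 ^ w e.2}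

/-- A minimal graded free resolution `⋯ → F₁ → F₀ → I → 0` of an ideal
`I` of the polynomial ring `S = k[x : x ∈ V]`, where `Fᵢ` is the graded free
module with (finite) homogeneous basis `ι i` whose element `a` sits in degree
`deg i a` (i.e. `Fᵢ = ⊕_a S(- deg i a)`), the maps are graded (degree-preserving)
`S`-linear maps, the complex is exact, and all the matrix entries of the
differentials lie in the maximal graded ideal `𝔪 = (x : x ∈ V)` (minimality). -/
structure MinFreeRes {V : Type} (I : Ideal (MvPolynomial V k)) where
  ι : ℕ → Type
  finite : ∀ i, Finite (ι i)
  deg : ∀ i, ι i → ℕ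
  aug : ((ι 0) →₀ MvPolynomial V k) →ₗ[MvPolynomial V k] MvPolynomial V k
  d : ∀ i, ((ι (i + 1)) →₀ MvPolynomial V k) →ₗ[MvPolynomial V k] ((ι i) →₀ MvPolynomial V k)
  aug_range : LinearMap.range aug = I
  exact_zero : LinearMap.range (d 0) = LinearMap.ker aug
  exact_succ : ∀ i, LinearMap.range (d (i + 1)) = LinearMap.ker (d i)
  aug_homog : ∀ a, (aug (Finsupp.single a 1)).IsHomogeneous (deg 0 a)
  d_homog : ∀ i a b, (d i (Finsupp.single a 1)) b = 0 ∨
      ∃ e, deg (i + 1) a = deg i b + e ∧ ((d i (Finsupp.single a 1)) b).IsHomogeneous e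
  minimal : ∀ i a b, (d i (Finsupp.single a 1)) b ∈ mIdeal k V

/-- The graded Betti number `β_{i,j}(I)`, read off from a minimal graded free
resolution: the number of basis elements of `Fᵢ` of degree `j`. -/
def MinFreeRes.betti {V : Type} {I : Ideal (MvPolynomial V k)} (R : MinFreeRes I)
    (i j : ℕ) : ℕ :=
  Nat.card {a : R.ι i // R.deg i a = j}

/-- The set `{j - i : β_{i,j}(I) ≠ 0}`; its greatest element is the
Castelnuovo–Mumford regularity `reg I`. -/
def MinFreeRes.regSet {V : Type} {I : Ideal (MvPolynomial V k)} (R : MinFreeRes I) :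
    Set ℤ :=
  {t : ℤ | ∃ i j : ℕ, R.betti i j ≠ 0 ∧ t = (j : ℤ) - (i : ℤ)}

/-- The set `{i : β_{i,j}(I) ≠ 0 for some j}`; its greatest element is the
projective dimension `pd I`. -/
def MinFreeRes.pdSet {V : Type} {I : Ideal (MvPolynomial V k)} (R : MinFreeRes I) :
    Set ℕ :=
  {i : ℕ | ∃ j : ℕ, R.betti i j ≠ 0}

/-- The set of lengths of `I`-regular sequences contained in the maximal graded
ideal `𝔪 = (x : x ∈ V)`; its greatest element is `depth I`. -/
def depthSet (k : Type) [Field k] {V : Type} (I : Ideal (MvPolynomial V k)) : Set ℕ :=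
  {n : ℕ | ∃ rs : List (MvPolynomial V k), rs.length = n ∧
    (∀ r ∈ rs, r ∈ mIdeal k V) ∧ RingTheory.Sequence.IsRegular (↥I) rs}

section Rees

open CategoryTheory Abelian RingTheory.Sequence Pointwise

variable {R : Type} [CommRing R]

lemma smul_top_quotSMulTop_lt {M : Type} [AddCommGroup M] [Module R M] {𝔪 : Ideal R} {x : R}
    (hx : x ∈ 𝔪) (h : 𝔪 • (⊤ : Submodule R M) < ⊤) :
    𝔪 • (⊤ : Submodule R (QuotSMulTop x M)) < ⊤ := by
  refine lt_top_iff_ne_top.mpr fun eq => h.ne ?_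
  have := congrArg (Submodule.comap (Submodule.mkQ _)) eq
  simpa [Submodule.comap_smul_top_of_surjective 𝔪 _ (Submodule.mkQ_surjective _),
    Submodule.smul_mono_left ((Ideal.span_singleton_le_iff_mem 𝔪).mpr hx),
    ← Submodule.ideal_span_singleton_smul] using this

/-- Killing a regular element shortens regular sequences by at most one. -/
lemma exists_isRegular_quotSMulTop [IsNoetherianRing R] {𝔪 : Ideal R} {M : Type}
    [AddCommGroup M] [Module R M] [Module.Finite R M] (h : 𝔪 • (⊤ : Submodule R M) < ⊤)
    {x : R} (hx : x ∈ 𝔪) (hreg : IsSMulRegular M x) {n : ℕ}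
    (hn : ∃ rs : List R, rs.length = n + 1 ∧ (∀ r ∈ rs, r ∈ 𝔪) ∧ IsRegular M rs) :
    ∃ rs : List R, rs.length = n ∧ (∀ r ∈ rs, r ∈ 𝔪) ∧ IsRegular (QuotSMulTop x M) rs := by
  have hext := ((ModuleCat.exists_isRegular_tfae 𝔪 (n + 1) (ModuleCat.of R M) h).out 3 1).mp hn
  refine ((ModuleCat.exists_isRegular_tfae 𝔪 n (ModuleCat.of R (QuotSMulTop x M))
    (smul_top_quotSMulTop_lt hx h)).out 1 3).mp fun i hi => ?_
  have zero₁ := AddCommGrpCat.isZero_of_iff_subsingleton.mpr (hext i (by omega))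
  have zero₂ := AddCommGrpCat.isZero_of_iff_subsingleton.mpr (hext (i + 1) (by omega))
  have hreg' : IsSMulRegular (ModuleCat.of R M) x := hreg
  exact AddCommGrpCat.subsingleton_of_isZero <| ShortComplex.Exact.isZero_of_both_zeros
    ((Ext.covariant_sequence_exact₃' _ hreg'.smulShortComplex_shortExact) i (i + 1) rfl)
    (zero₁.eq_zero_of_src _) (zero₂.eq_zero_of_tgt _)

/-- A regular sequence whose quotient has a nonzero socle is at least as long as any other. -/
lemma length_le_of_socle [IsNoetherianRing R] {𝔪 : Ideal R} (rs : List R) :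
    ∀ (M : Type) [AddCommGroup M] [Module R M] [Module.Finite R M],
      𝔪 • (⊤ : Submodule R M) < ⊤ → (∀ r ∈ rs, r ∈ 𝔪) → IsWeaklyRegular M rs →
      (∃ e : M ⧸ (Ideal.ofList rs • ⊤ : Submodule R M), e ≠ 0 ∧ ∀ x ∈ 𝔪, x • e = 0) →
      ∀ n, (∃ rs' : List R, rs'.length = n ∧ (∀ r ∈ rs', r ∈ 𝔪) ∧ IsRegular M rs') →
      n ≤ rs.length := by
  induction rs with
  | nil =>
    rintro M _ _ _ - - - ⟨e, he, hsoc⟩ n ⟨rs', rfl, hmem, hreg⟩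
    match rs' with
    | [] => simp
    | r :: rs' =>
      exfalso
      have hr := ((isRegular_cons_iff M r rs').mp hreg).1
      have hbot : (Ideal.ofList ([] : List R) • ⊤ : Submodule R M) = ⊥ := by simp
      let eq := Submodule.quotEquivOfEqBot _ hbot
      have h0 : r • eq e = 0 := by
        rw [← map_smul, hsoc r (hmem r (by simp)), map_zero]
      exact he (eq.map_eq_zero_iff.mp (hr (by simpa using h0)))
  | cons x rs ih =>
    rintro M _ _ _ hlt hmem hreg ⟨e, he, hsoc⟩ n hn
    obtain ⟨hx, hrs⟩ := (isWeaklyRegular_cons_iff M x rs).mp hreg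
    cases n with
    | zero => simp
    | succ n =>
      let eq := Submodule.quotOfListConsSMulTopEquivQuotSMulTopInner M x rs
      have := ih (QuotSMulTop x M) (smul_top_quotSMulTop_lt (hmem x (by simp)) hlt)
        (fun r hr => hmem r (by simp [hr])) hrs
        ⟨eq e, by simpa using he, fun y hy => by rw [← map_smul, hsoc y hy, map_zero]⟩ n
        (exists_isRegular_quotSMulTop hlt (hmem x (by simp)) hx hn)
      simpa using this

end Rees

section Ideal

open RingTheory.Sequence

variable {R : Type} [CommRing R] {I : Ideal R}

lemma ofList_take_succ (l : List R) {i : ℕ} (hi : i < l.length) :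
    Ideal.ofList (l.take (i + 1)) = Ideal.ofList (l.take i) ⊔ Ideal.span {l[i]} := by
  rw [List.take_succ_eq_append_getElem hi, Ideal.ofList_append, Ideal.ofList_singleton]

/-- If `θ` is weakly regular on `R ⧸ I` then `(θ) ∩ I = (θ) I`. -/
lemma mem_ofList_mul {l : List R}
    (hl : ∀ i (hi : i < l.length) f, l[i] * f ∈ I ⊔ Ideal.ofList (l.take i) →
      f ∈ I ⊔ Ideal.ofList (l.take i)) :
    ∀ i ≤ l.length, ∀ f ∈ I, f ∈ Ideal.ofList (l.take i) → f ∈ Ideal.ofList (l.take i) * I := by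
  intro i
  induction i with
  | zero => intro _ f _ hf; simpa using hf
  | succ i ih =>
    intro hi f hfI hf
    rw [ofList_take_succ l hi] at hf ⊢
    obtain ⟨g, hg, h, hh, rfl⟩ := Submodule.mem_sup.mp hf
    obtain ⟨h, rfl⟩ := Ideal.mem_span_singleton'.mp hh
    have h1 : l[i] * h ∈ I ⊔ Ideal.ofList (l.take i) := by
      have : l[i] * h = (g + h * l[i]) - g := by ring
      rw [this]
      exact sub_mem (Ideal.mem_sup_left hfI) (Ideal.mem_sup_right hg)
    obtain ⟨h', hh', g', hg', rfl⟩ := Submodule.mem_sup.mp (hl i hi h h1)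
    have h2 : g + l[i] * g' ∈ Ideal.ofList (l.take i) * I := by
      refine ih (by omega) _ ?_ (add_mem hg (Ideal.mul_mem_left _ _ hg'))
      have : g + l[i] * g' = (g + (h' + g') * l[i]) - l[i] * h' := by ring
      rw [this]
      exact sub_mem hfI (Ideal.mul_mem_left _ _ hh')
    have : g + (h' + g') * l[i] = (g + l[i] * g') + l[i] * h' := by ring
    rw [this, Ideal.sup_mul]
    exact add_mem (Ideal.mem_sup_left h2)
      (Ideal.mem_sup_right (Ideal.mul_mem_mul (Ideal.mem_span_singleton_self _) hh'))

lemma mem_smul_top_iff_mem_mul {J : Ideal R} {x : I} :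
    x ∈ (J • ⊤ : Submodule R I) ↔ (x : R) ∈ J * I := by
  rw [Submodule.mem_smul_top_iff, smul_eq_mul]

/-- A sequence that is weakly regular on `R` and `R ⧸ I`, followed by an element that is regular
modulo it, is weakly regular on `I`. -/
lemma isWeaklyRegular_append_singleton {l : List R}
    (hl : ∀ i (hi : i < l.length) f, l[i] * f ∈ Ideal.ofList (l.take i) →
      f ∈ Ideal.ofList (l.take i))
    (hlI : ∀ i (hi : i < l.length) f, l[i] * f ∈ I ⊔ Ideal.ofList (l.take i) →
      f ∈ I ⊔ Ideal.ofList (l.take i))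
    {p : R} (hp : ∀ f, p * f ∈ Ideal.ofList l → f ∈ Ideal.ofList l) :
    IsWeaklyRegular I (l ++ [p]) := by
  have key (J : Ideal R) (r : R) (hJ : ∀ f ∈ I, f ∈ J → f ∈ J * I)
      (hr : ∀ f, r * f ∈ J → f ∈ J) : IsSMulRegular (I ⧸ (J • ⊤ : Submodule R I)) r := by
    rw [isSMulRegular_quotient_iff_mem_of_smul_mem]
    intro f hf
    rw [mem_smul_top_iff_mem_mul] at hf ⊢
    rw [Submodule.coe_smul, smul_eq_mul] at hf
    exact hJ _ f.2 (hr _ (Ideal.mul_le_left hf))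
  rw [isWeaklyRegular_append_iff, isWeaklyRegular_singleton_iff, isWeaklyRegular_iff]
  refine ⟨fun i hi => key _ _ (mem_ofList_mul hlI i hi.le) (hl i hi), key _ _ ?_ hp⟩
  simpa only [List.take_length] using mem_ofList_mul hlI l.length le_rfl

/-- A socle element `u` of `R ⧸ (I + (θ))` yields the socle element `p u` of
`I ⧸ (θ, p) I`. -/
lemma exists_socle_append_singleton {l : List R} {𝔪 : Ideal R}
    {p : R} (hpI : p ∈ I) (hp : ∀ f, p * f ∈ Ideal.ofList l → f ∈ Ideal.ofList l)
    {u : R} (hu : u ∉ I ⊔ Ideal.ofList l) (hsoc : ∀ x ∈ 𝔪, x * u ∈ I ⊔ Ideal.ofList l) :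
    ∃ e : I ⧸ (Ideal.ofList (l ++ [p]) • ⊤ : Submodule R I), e ≠ 0 ∧ ∀ x ∈ 𝔪, x • e = 0 := by
  refine ⟨Submodule.Quotient.mk ⟨p * u, Ideal.mul_mem_right _ _ hpI⟩, ?_, fun x hx => ?_⟩
  · rw [ne_eq, Submodule.Quotient.mk_eq_zero, mem_smul_top_iff_mem_mul, Ideal.ofList_append,
      Ideal.ofList_singleton, Ideal.sup_mul]
    intro h
    obtain ⟨a, ha, b, hb, hab⟩ := Submodule.mem_sup.mp h
    obtain ⟨c, hc, rfl⟩ := Ideal.mem_span_singleton_mul.mp hb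
    have h1 : u - c ∈ Ideal.ofList l := by
      refine hp _ ?_
      have : p * (u - c) = a := by rw [mul_sub]; exact sub_eq_of_eq_add hab.symm
      rw [this]
      exact Ideal.mul_le_left ha
    refine hu ?_
    have : u = c + (u - c) := by ring
    rw [this]
    exact Submodule.add_mem_sup hc h1
  · rw [← Submodule.Quotient.mk_smul, Submodule.Quotient.mk_eq_zero, mem_smul_top_iff_mem_mul,
      Ideal.ofList_append, Ideal.ofList_singleton, Ideal.sup_mul, Submodule.coe_smul, smul_eq_mul]
    obtain ⟨a, ha, b, hb, hab⟩ := Submodule.mem_sup.mp (hsoc x hx)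
    have : x * (p * u) = b * p + p * a := by
      rw [mul_left_comm, ← hab]; ring
    rw [this]
    exact Submodule.add_mem_sup (Ideal.mul_mem_mul hb hpI)
      (Ideal.mul_mem_mul (Ideal.mem_span_singleton_self _) ha)

/-- Nakayama for a nonzero ideal of a domain. -/
lemma smul_top_lt_top [IsDomain R] [IsNoetherianRing R] {𝔪 : Ideal R} (h𝔪 : 𝔪 ≠ ⊤)
    (hI : I ≠ ⊥) : 𝔪 • (⊤ : Submodule R I) < ⊤ := by
  refine lt_top_iff_ne_top.mpr fun h => ?_
  obtain ⟨r, hr, hr0⟩ := Submodule.exists_sub_one_mem_and_smul_eq_zero_of_fg_of_le_smul 𝔪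
    (⊤ : Submodule R I) Module.Finite.fg_top h.ge
  obtain ⟨p, hpI, hp0⟩ := Submodule.exists_mem_ne_zero_of_ne_bot hI
  have h0 : r * p = 0 := congrArg Subtype.val (hr0 ⟨p, hpI⟩ trivial)
  obtain rfl := (mul_eq_zero.mp h0).resolve_right hp0
  exact h𝔪 ((Ideal.eq_top_iff_one _).mpr (by simpa using hr))

/-- The depth of a nonzero ideal of a Noetherian domain is determined by a sequence that is
regular on `R` and on `R ⧸ I` and maximal on `R ⧸ I`. -/
lemma isGreatest_length_isRegular {R : Type} [CommRing R] [IsDomain R] [IsNoetherianRing R]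
    {I 𝔪 : Ideal R} (h𝔪 : 𝔪 ≠ ⊤) {l : List R} (hmem : ∀ r ∈ l, r ∈ 𝔪)
    (hl : ∀ i (hi : i < l.length) f, l[i] * f ∈ Ideal.ofList (l.take i) →
      f ∈ Ideal.ofList (l.take i))
    (hlI : ∀ i (hi : i < l.length) f, l[i] * f ∈ I ⊔ Ideal.ofList (l.take i) →
      f ∈ I ⊔ Ideal.ofList (l.take i))
    {p : R} (hp0 : p ≠ 0) (hpI : p ∈ I) (hpm : p ∈ 𝔪)
    (hp : ∀ f, p * f ∈ Ideal.ofList l → f ∈ Ideal.ofList l)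
    {u : R} (hu : u ∉ I ⊔ Ideal.ofList l) (hsoc : ∀ x ∈ 𝔪, x * u ∈ I ⊔ Ideal.ofList l) :
    IsGreatest {n : ℕ | ∃ rs : List R, rs.length = n ∧ (∀ r ∈ rs, r ∈ 𝔪) ∧ IsRegular I rs}
      (l.length + 1) := by
  have hlt : 𝔪 • (⊤ : Submodule R I) < ⊤ :=
    smul_top_lt_top h𝔪 (Submodule.ne_bot_iff _ |>.mpr ⟨p, hpI, hp0⟩)
  have hmem' : ∀ r ∈ l ++ [p], r ∈ 𝔪 := by
    intro r hr
    rcases List.mem_append.mp hr with h | h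
    · exact hmem r h
    · rwa [List.mem_singleton.mp h]
  have hreg := isWeaklyRegular_append_singleton hl hlI hp
  refine ⟨⟨l ++ [p], by simp, hmem', hreg, fun h => hlt.not_ge ?_⟩, fun n hn => ?_⟩
  · exact h.le.trans (Submodule.smul_mono_left (Ideal.span_le.mpr hmem'))
  · simpa using length_le_of_socle (l ++ [p]) I hlt hmem' hreg
      (exists_socle_append_singleton hpI hp hu hsoc) n hn

end Ideal

section Monomial

/-- The monomial ideal generated by the monomials with exponents in `G`. -/
def monomialIdeal (k : Type) [Field k] {V : Type} (G : Set (V →₀ ℕ)) : Ideal (MvPolynomial V k) :=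
  Ideal.span ((fun g => monomial g (1 : k)) '' G)

variable {V : Type} {G : Set (V →₀ ℕ)}

lemma mem_monomialIdeal {f : MvPolynomial V k} :
    f ∈ monomialIdeal k G ↔ ∀ u ∈ f.support, ∃ g ∈ G, g ≤ u :=
  mem_ideal_span_monomial_image

lemma monomial_mem_monomialIdeal {u : V →₀ ℕ} :
    monomial u (1 : k) ∈ monomialIdeal k G ↔ ∃ g ∈ G, g ≤ u := by
  classical
  simp [mem_monomialIdeal, support_monomial]

lemma exists_mem_support_of_X_sub_X_mul_mem {y z : V} {f : MvPolynomial V k}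
    (hf : (X y - X z) * f ∈ monomialIdeal k G) {v : V →₀ ℕ} (hv : v ∈ f.support)
    (hvz : ¬ ∃ g ∈ G, g ≤ v + Finsupp.single z 1) :
    ∃ v' ∈ f.support, v' + Finsupp.single y 1 = v + Finsupp.single z 1 := by
  classical
  have h0 : coeff (v + Finsupp.single z 1) ((X y - X z) * f) = 0 := by
    by_contra h
    exact hvz (mem_monomialIdeal.mp hf _ (mem_support_iff.mpr h))
  rw [sub_mul, coeff_sub, mul_comm (X z), coeff_mul_X, coeff_X_mul', sub_eq_zero] at h0
  rw [mem_support_iff] at hv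
  split_ifs at h0 with hy
  · refine ⟨v + Finsupp.single z 1 - Finsupp.single y 1, mem_support_iff.mpr (h0 ▸ hv), ?_⟩
    refine tsub_add_cancel_of_le (Finsupp.single_le_iff.mpr ?_)
    exact Nat.one_le_iff_ne_zero.mpr (Finsupp.mem_support_iff.mp hy)
  · exact absurd h0.symm hv

/-- If a monomial ideal is generated by monomials that are squarefree in `z`, and no monomial
outside it is multiplied into it by both `y` and `z`, then `y - z` is regular modulo it. -/
lemma mem_of_X_sub_X_mul_mem {y z : V} (hyz : y ≠ z) (hz : ∀ g ∈ G, g z ≤ 1)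
    (hcolon : ∀ u, (∃ g ∈ G, g ≤ u + Finsupp.single y 1) → (∃ g ∈ G, g ≤ u + Finsupp.single z 1) →
      ∃ g ∈ G, g ≤ u)
    {f : MvPolynomial V k} (hf : (X y - X z) * f ∈ monomialIdeal k G) :
    f ∈ monomialIdeal k G := by
  have hf' : (X z - X y) * f ∈ monomialIdeal k G := by
    rw [← neg_sub, neg_mul]
    exact neg_mem hf
  have hdesc : ∀ (n : ℕ) (v : V →₀ ℕ), v y = n → v ∈ f.support → 1 ≤ v z → ∃ g ∈ G, g ≤ v := by
    intro n
    induction n with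
    | zero =>
      intro v hvy hv hvz
      by_contra hvG
      have hne : ¬ ∃ g ∈ G, g ≤ v + Finsupp.single z 1 := by
        rintro ⟨g, hg, hle⟩
        refine hvG ⟨g, hg, fun x => ?_⟩
        rcases eq_or_ne x z with rfl | hx
        · exact (hz g hg).trans hvz
        · simpa [Finsupp.single_eq_of_ne hx] using hle x
      obtain ⟨v', -, h⟩ := exists_mem_support_of_X_sub_X_mul_mem hf hv hne
      have := DFunLike.congr_fun h y
      simp [Finsupp.single_eq_of_ne hyz, hvy] at this
    | succ n ih =>
      intro v hvy hv hvz
      by_contra hvG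
      have hne : ¬ ∃ g ∈ G, g ≤ v + Finsupp.single z 1 := by
        rintro ⟨g, hg, hle⟩
        refine hvG ⟨g, hg, fun x => ?_⟩
        rcases eq_or_ne x z with rfl | hx
        · exact (hz g hg).trans hvz
        · simpa [Finsupp.single_eq_of_ne hx] using hle x
      obtain ⟨v', hv', h⟩ := exists_mem_support_of_X_sub_X_mul_mem hf hv hne
      have hy' := DFunLike.congr_fun h y
      have hz' := DFunLike.congr_fun h z
      simp [Finsupp.single_eq_of_ne hyz, Finsupp.single_eq_of_ne hyz.symm, hvy] at hy' hz'
      obtain ⟨g, hg, hle⟩ := ih v' hy' hv' (by omega)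
      exact hne ⟨g, hg, h ▸ hle.trans le_self_add⟩
  rw [mem_monomialIdeal]
  intro u hu
  by_contra huG
  rcases not_and_or.mp (fun h => huG (hcolon u h.1 h.2)) with h | h
  · obtain ⟨v, -, hv⟩ := exists_mem_support_of_X_sub_X_mul_mem hf' hu h
    have := DFunLike.congr_fun hv z
    simp [Finsupp.single_eq_of_ne hyz.symm] at this
    exact huG (hdesc _ u rfl hu (by omega))
  · obtain ⟨v, hvs, hv⟩ := exists_mem_support_of_X_sub_X_mul_mem hf hu h
    have := DFunLike.congr_fun hv z
    simp [Finsupp.single_eq_of_ne hyz.symm] at this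
    obtain ⟨g, hg, hle⟩ := hdesc _ v rfl hvs (by omega)
    exact h ⟨g, hg, hv ▸ hle.trans le_self_add⟩

end Monomial

section Collapse

variable {V : Type}

/-- The ideal generated by `y - τ y` for `y ∈ l`. -/
def collapseIdeal (k : Type) [Field k] (τ : V → V) (l : List V) : Ideal (MvPolynomial V k) :=
  Ideal.ofList (l.map fun y => X y - X (τ y))

lemma X_sub_X_mem_collapseIdeal {τ : V → V} {l : List V} {y : V} (hy : y ∈ l) :
    (X y - X (τ y) : MvPolynomial V k) ∈ collapseIdeal k τ l :=
  Ideal.subset_span (List.mem_map.mpr ⟨y, hy, rfl⟩)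

variable [DecidableEq V]

/-- The map moving the vertices of `l` along `τ` and fixing all others. -/
def collapse (τ : V → V) (l : List V) (v : V) : V := if v ∈ l then τ v else v

lemma collapse_of_mem {τ : V → V} {l : List V} {v : V} (h : v ∈ l) : collapse τ l v = τ v :=
  if_pos h

lemma collapse_of_notMem {τ : V → V} {l : List V} {v : V} (h : v ∉ l) : collapse τ l v = v :=
  if_neg h

lemma sub_rename_mem_collapseIdeal (τ : V → V) (l : List V) (f : MvPolynomial V k) :
    f - rename (collapse τ l) f ∈ collapseIdeal k τ l := by
  induction f using MvPolynomial.induction_on with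
  | C a => simp
  | add p q hp hq =>
    rw [map_add, add_sub_add_comm]
    exact add_mem hp hq
  | mul_X p v hp =>
    have hX : (X v - X (collapse τ l v) : MvPolynomial V k) ∈ collapseIdeal k τ l := by
      by_cases hv : v ∈ l
      · rw [collapse_of_mem hv]
        exact X_sub_X_mem_collapseIdeal hv
      · simp [collapse_of_notMem hv]
    rw [map_mul, rename_X]
    have : p * X v - rename (collapse τ l) p * X (collapse τ l v) =
        (p - rename (collapse τ l) p) * X v +
          rename (collapse τ l) p * (X v - X (collapse τ l v)) := by ring
    rw [this]
    exact add_mem (Ideal.mul_mem_right _ _ hp) (Ideal.mul_mem_left _ _ hX)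

lemma mem_collapseIdeal_iff {τ : V → V} {l : List V} (hτ : ∀ y ∈ l, τ y ∉ l)
    {f : MvPolynomial V k} : f ∈ collapseIdeal k τ l ↔ rename (collapse τ l) f = 0 := by
  refine ⟨fun hf => ?_, fun hf => ?_⟩
  · have : collapseIdeal k τ l ≤ RingHom.ker (rename (R := k) (collapse τ l)) := by
      refine Ideal.span_le.mpr fun r hr => ?_
      obtain ⟨y, hy, rfl⟩ := List.mem_map.mp hr
      simp [collapse_of_mem hy, collapse_of_notMem (hτ y hy)]
    exact this hf
  · simpa [hf] using sub_rename_mem_collapseIdeal τ l f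

lemma mem_monomialIdeal_sup_collapseIdeal_iff {τ : V → V} {l : List V} (hτ : ∀ y ∈ l, τ y ∉ l)
    {G : Set (V →₀ ℕ)} {f : MvPolynomial V k} :
    f ∈ monomialIdeal k G ⊔ collapseIdeal k τ l ↔
      rename (collapse τ l) f ∈ monomialIdeal k (Finsupp.mapDomain (collapse τ l) '' G) := by
  refine ⟨fun hf => ?_, fun hf => ?_⟩
  · have : monomialIdeal k G ⊔ collapseIdeal k τ l ≤ Ideal.comap (rename (R := k) (collapse τ l))
        (monomialIdeal k (Finsupp.mapDomain (collapse τ l) '' G)) := by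
      refine sup_le (Ideal.span_le.mpr ?_) fun g hg => ?_
      · rintro _ ⟨g, hg, rfl⟩
        rw [SetLike.mem_coe, Ideal.mem_comap, rename_monomial]
        exact Ideal.subset_span ⟨_, ⟨g, hg, rfl⟩, rfl⟩
      · rw [Ideal.mem_comap, (mem_collapseIdeal_iff hτ).mp hg]
        exact zero_mem _
    exact this hf
  · have : monomialIdeal k (Finsupp.mapDomain (collapse τ l) '' G) ≤
        monomialIdeal k G ⊔ collapseIdeal k τ l := by
      refine Ideal.span_le.mpr ?_
      rintro _ ⟨_, ⟨g, hg, rfl⟩, rfl⟩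
      have h := sub_rename_mem_collapseIdeal τ l (monomial g (1 : k))
      rw [rename_monomial] at h
      have h' : monomial g (1 : k) ∈ monomialIdeal k G := Ideal.subset_span ⟨g, hg, rfl⟩
      simpa using sub_mem (Ideal.mem_sup_left h') (Ideal.mem_sup_right h)
    simpa using add_mem (Ideal.mem_sup_right (sub_rename_mem_collapseIdeal τ l f)) (this hf)

/-- The depth of a monomial ideal that can be collapsed, one variable at a time and along regular
elements, to an ideal with the socle monomial `u`. -/
theorem isGreatest_depthSet_of_collapse [Finite V] {G : Set (V →₀ ℕ)} (hG : G.Nonempty)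
    (hG0 : 0 ∉ G) {τ : V → V} {l : List V} (hl : l.Nodup) (hτ : ∀ y ∈ l, τ y ∉ l)
    (hreg : ∀ i (hi : i < l.length) (f : MvPolynomial V k), (X l[i] - X (τ l[i])) * f ∈
        monomialIdeal k (Finsupp.mapDomain (collapse τ (l.take i)) '' G) →
      f ∈ monomialIdeal k (Finsupp.mapDomain (collapse τ (l.take i)) '' G))
    {u : V →₀ ℕ} (hul : ∀ y ∈ l, u y = 0)
    (hu : ∀ g ∈ G, ¬ Finsupp.mapDomain (collapse τ l) g ≤ u)
    (hsoc : ∀ x ∉ l, ∃ g ∈ G, Finsupp.mapDomain (collapse τ l) g ≤ u + Finsupp.single x 1) :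
    IsGreatest (depthSet k (monomialIdeal k G)) (l.length + 1) := by
  have hlen : (l.map fun y => (X y - X (τ y) : MvPolynomial V k)).length = l.length := by simp
  have hτ' (i : ℕ) : ∀ y ∈ l.take i, τ y ∉ l.take i := fun y hy h =>
    hτ y (List.mem_of_mem_take hy) (List.mem_of_mem_take h)
  have htake (i : ℕ) : Ideal.ofList ((l.map fun y => (X y - X (τ y) : MvPolynomial V k)).take i) =
      collapseIdeal k τ (l.take i) := by
    rw [collapseIdeal, List.map_take]
  have hfix (i : ℕ) (hi : i < l.length) :
      rename (collapse τ (l.take i)) (X l[i] - X (τ l[i]) : MvPolynomial V k) =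
        X l[i] - X (τ l[i]) := by
    have h1 : l[i] ∉ l.take i := by
      intro h
      obtain ⟨j, hj, hji⟩ := List.mem_take_iff_getElem.mp h
      have := (hl.getElem_inj_iff).mp hji
      omega
    have h2 : τ l[i] ∉ l.take i := fun h =>
      hτ _ (List.getElem_mem hi) (List.mem_of_mem_take h)
    rw [map_sub, rename_X, rename_X, collapse_of_notMem h1, collapse_of_notMem h2]
  have huρ : Finsupp.mapDomain (collapse τ l) u = u := by
    conv_rhs => rw [← Finsupp.mapDomain_id (v := u)]
    refine Finsupp.mapDomain_congr fun x hx => collapse_of_notMem fun hxl => ?_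
    exact Finsupp.mem_support_iff.mp hx (hul x hxl)
  have hX (v : V) : (X v : MvPolynomial V k) ∈ mIdeal k V := Ideal.subset_span ⟨v, rfl⟩
  have hm : mIdeal k V ≤ RingHom.ker (constantCoeff (R := k) (σ := V)) := by
    refine Ideal.span_le.mpr ?_
    rintro _ ⟨v, rfl⟩
    simp
  obtain ⟨g, hg⟩ := hG
  rw [← hlen]
  refine isGreatest_length_isRegular (p := monomial g (1 : k)) (u := monomial u (1 : k))
    ?_ ?_ ?_ ?_ ?_ ?_ ?_ ?_ ?_ ?_
  · intro h
    have := hm (h ▸ Submodule.mem_top : (1 : MvPolynomial V k) ∈ mIdeal k V)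
    simp at this
  · intro r hr
    obtain ⟨y, -, rfl⟩ := List.mem_map.mp hr
    exact sub_mem (hX _) (hX _)
  · intro i hi f hf
    rw [hlen] at hi
    rw [List.getElem_map, htake, mem_collapseIdeal_iff (hτ' i), map_mul, hfix i hi] at hf
    rw [htake, mem_collapseIdeal_iff (hτ' i)]
    refine (mul_eq_zero.mp hf).resolve_left fun h => hτ l[i] (List.getElem_mem hi) ?_
    rw [← X_injective (sub_eq_zero.mp h)]
    exact List.getElem_mem hi
  · intro i hi f hf
    rw [hlen] at hi
    rw [List.getElem_map, htake, mem_monomialIdeal_sup_collapseIdeal_iff (hτ' i), map_mul,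
      hfix i hi] at hf
    rw [htake, mem_monomialIdeal_sup_collapseIdeal_iff (hτ' i)]
    exact hreg i hi _ hf
  · simp
  · exact Ideal.subset_span ⟨g, hg, rfl⟩
  · obtain ⟨v, hv⟩ : ∃ v, g v ≠ 0 := by
      by_contra! h
      exact hG0 ((Finsupp.ext h : g = 0) ▸ hg)
    have : (X v : MvPolynomial V k) ∣ monomial g 1 := by
      rw [X_dvd_monomial]
      exact Or.inr hv
    exact Ideal.mem_of_dvd _ this (hX v)
  · intro f hf
    change _ ∈ collapseIdeal k τ l at hf
    change _ ∈ collapseIdeal k τ l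
    rw [mem_collapseIdeal_iff hτ, map_mul, rename_monomial] at hf
    rw [mem_collapseIdeal_iff hτ]
    exact (mul_eq_zero.mp hf).resolve_left (by simp)
  · change _ ∉ _ ⊔ collapseIdeal k τ l
    rw [mem_monomialIdeal_sup_collapseIdeal_iff hτ, rename_monomial, monomial_mem_monomialIdeal,
      huρ]
    rintro ⟨_, ⟨g, hg, rfl⟩, hle⟩
    exact hu g hg hle
  · change ∀ x ∈ mIdeal k V, _ ∈ _ ⊔ collapseIdeal k τ l
    intro x hx
    refine Submodule.span_induction (p := fun x _ => x * monomial u (1 : k) ∈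
      monomialIdeal k G ⊔ collapseIdeal k τ l) ?_ ?_ ?_ ?_ hx
    · rintro _ ⟨v, rfl⟩
      have hv : collapse τ l v ∉ l := by
        by_cases hv : v ∈ l
        · rw [collapse_of_mem hv]
          exact hτ v hv
        · rwa [collapse_of_notMem hv]
      obtain ⟨g, hg, hle⟩ := hsoc _ hv
      rw [mem_monomialIdeal_sup_collapseIdeal_iff hτ, map_mul, rename_X, rename_monomial, huρ,
        X, monomial_mul, one_mul, monomial_mem_monomialIdeal, add_comm]
      exact ⟨_, ⟨g, hg, rfl⟩, hle⟩
    · simp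
    · intro a b _ _ ha hb
      rw [add_mul]
      exact add_mem ha hb
    · intro a b _ hb
      rw [smul_eq_mul, mul_assoc]
      exact Ideal.mul_mem_left _ _ hb

end Collapse

section SecondClass

variable {V : Type} {P : V → ℕ} {s : V → V} {w : V → ℕ} {E : Set (V × V)}

/-- The exponent of the generator of the edge ideal given by the edge `e`. -/
def edgeExp (w : V → ℕ) (e : V × V) : V →₀ ℕ :=
  Finsupp.single e.1 1 + Finsupp.single e.2 (w e.2)

lemma edgeIdeal_eq_monomialIdeal (k : Type) [Field k] (E : Set (V × V)) (w : V → ℕ) :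
    edgeIdeal k E w = monomialIdeal k (edgeExp w '' E) := by
  have h (e : V × V) : monomial (edgeExp w e) (1 : k) = X e.1 * X e.2 ^ w e.2 := by
    rw [X_pow_eq_monomial, X, monomial_mul, one_mul, edgeExp]
  rw [edgeIdeal, monomialIdeal, Set.image_image]
  congr 1
  ext p
  simp only [h, Set.mem_ofPred_eq, Set.mem_image, eq_comm]

lemma mapDomain_edgeExp (ρ : V → V) (p q : V) :
    Finsupp.mapDomain ρ (edgeExp w (p, q)) =
      Finsupp.single (ρ p) 1 + Finsupp.single (ρ q) (w q) := by
  simp [edgeExp, Finsupp.mapDomain_add, Finsupp.mapDomain_single]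

lemma single_add_single_le_of_ne {p q : V} (hpq : p ≠ q) {n : ℕ} {u : V →₀ ℕ} (hp : 1 ≤ u p)
    (hq : n ≤ u q) : Finsupp.single p 1 + Finsupp.single q n ≤ u := by
  classical
  intro x
  simp only [Finsupp.add_apply, Finsupp.single_apply]
  split_ifs with h₁ h₂ h₂
  · exact absurd (h₁.trans h₂.symm) hpq
  · simpa [← h₁] using hp
  · simpa [← h₂] using hq
  · simp

lemma single_add_single_le_of_eq {p : V} {n : ℕ} {u : V →₀ ℕ} (h : n + 1 ≤ u p) :
    Finsupp.single p 1 + Finsupp.single p n ≤ u := by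
  rw [← Finsupp.single_add, add_comm]
  exact Finsupp.single_le_iff.mpr h

lemma le_of_single_add_single_le {p q : V} {n : ℕ} {u : V →₀ ℕ}
    (h : Finsupp.single p 1 + Finsupp.single q n ≤ u) : 1 ≤ u p ∧ n ≤ u q :=
  ⟨by simpa using (le_self_add.trans h : Finsupp.single p 1 ≤ u) p,
    by simpa using (le_add_self.trans h : Finsupp.single q n ≤ u) q⟩

lemma succ_le_of_single_add_single_le {p : V} {n : ℕ} {u : V →₀ ℕ}
    (h : Finsupp.single p 1 + Finsupp.single p n ≤ u) : n + 1 ≤ u p := by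
  simpa [add_comm] using h p

lemma le_of_le_add_single {g u : V →₀ ℕ} {x : V} (h : g ≤ u + Finsupp.single x 1)
    (hx : g x ≤ u x) : g ≤ u := by
  intro v
  rcases eq_or_ne v x with rfl | hv
  · exact hx
  · simpa [Finsupp.single_eq_of_ne hv] using h v

/-- The data of a weighted oriented graph of the second class: `P` numbers the parts from `0`,
and `s` is the matching of part `0` into part `1`. -/
structure IsSecondClass (P : V → ℕ) (s : V → V) (w : V → ℕ) (E : Set (V × V)) : Prop where
  mem_iff : ∀ p q, (p, q) ∈ E ↔ (P q = 0 ∧ p = s q) ∨ (1 ≤ P p ∧ P q = P p + 1)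
  matching : ∀ v, P v = 0 → P (s v) = 1
  matching_injOn : ∀ v v', P v = 0 → P v' = 0 → s v = s v' → v = v'
  exists_part : ∀ x n, n ≤ P x → ∃ v, P v = n
  weight_pos : ∀ v, 1 ≤ w v
  two_le_weight : ∀ v x, 2 ≤ P v → P x = P v + 1 → 2 ≤ w v

namespace IsSecondClass

lemma one_le_part_fst (h : IsSecondClass P s w E) {p q : V} (he : (p, q) ∈ E) : 1 ≤ P p := by
  rcases (h.mem_iff p q).mp he with ⟨hq, rfl⟩ | ⟨hp, -⟩
  · exact (h.matching q hq).ge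
  · exact hp

lemma part_snd_ne_one (h : IsSecondClass P s w E) {p q : V} (he : (p, q) ∈ E) : P q ≠ 1 := by
  rcases (h.mem_iff p q).mp he with ⟨hq, -⟩ | ⟨hp, hq⟩ <;> omega

lemma mem_matching (h : IsSecondClass P s w E) {a : V} (ha : P a = 0) : (s a, a) ∈ E :=
  (h.mem_iff _ _).mpr (Or.inl ⟨ha, rfl⟩)

lemma mem_of_part (h : IsSecondClass P s w E) {p q : V} (hp : 1 ≤ P p) (hq : P q = P p + 1) :
    (p, q) ∈ E :=
  (h.mem_iff _ _).mpr (Or.inr ⟨hp, hq⟩)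

lemma zero_notMem (h : IsSecondClass P s w E) : (0 : V →₀ ℕ) ∉ edgeExp w '' E := by
  rintro ⟨e, -, he⟩
  have := h.weight_pos e.2
  have h2 := DFunLike.congr_fun he e.2
  simp [edgeExp] at h2
  omega

variable [DecidableEq V]

/-- Identifying an end `a` of the matching with its partner is a regular operation, also after
other vertices have been collapsed. -/
lemma regular_matching (h : IsSecondClass P s w E) {τ : V → V} {l : List V}
    (hl : ∀ v ∈ l, (P v = 0 ∧ τ v = s v) ∨ (P (τ v) = 2 ∧ ∀ a, P a = 0 → s a ≠ v)) {a : V}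
    (ha : P a = 0) (hal : a ∉ l) {f : MvPolynomial V k}
    (hf : (X a - X (s a)) * f ∈
      monomialIdeal k (Finsupp.mapDomain (collapse τ l) '' (edgeExp w '' E))) :
    f ∈ monomialIdeal k (Finsupp.mapDomain (collapse τ l) '' (edgeExp w '' E)) := by
  have hsa := h.matching a ha
  have hsl : s a ∉ l := by
    intro hmem
    rcases hl _ hmem with ⟨h0, -⟩ | ⟨-, h'⟩
    · omega
    · exact h' a ha rfl
  have hτ0 (v : V) (hv : v ∈ l) : τ v ≠ a := by
    rintro rfl
    rcases hl v hv with ⟨h0, h1⟩ | ⟨h2, -⟩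
    · have := h.matching v h0
      rw [← h1] at this
      omega
    · omega
  have hsnd {p q : V} (he : (p, q) ∈ E) : collapse τ l q ≠ s a := by
    intro hq
    by_cases hql : q ∈ l
    · rw [collapse_of_mem hql] at hq
      rcases hl q hql with ⟨h0, h1⟩ | ⟨h2, -⟩
      · exact hal (h.matching_injOn q a h0 ha (h1 ▸ hq) ▸ hql)
      · rw [hq] at h2
        omega
    · rw [collapse_of_notMem hql] at hq
      exact h.part_snd_ne_one he (hq ▸ hsa)
  have hsq : ∀ g ∈ Finsupp.mapDomain (collapse τ l) '' (edgeExp w '' E), g (s a) ≤ 1 := by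
    rintro _ ⟨_, ⟨⟨p, q⟩, he, rfl⟩, rfl⟩
    rw [mapDomain_edgeExp, Finsupp.add_apply, Finsupp.single_eq_of_ne (hsnd he).symm,
      Finsupp.single_apply]
    split_ifs <;> simp
  refine mem_of_X_sub_X_mul_mem (fun h' => by rw [← h'] at hsa; omega) hsq ?_ hf
  rintro u ⟨_, ⟨_, ⟨⟨p, q⟩, he, rfl⟩, rfl⟩, hle⟩ ⟨g, hg, hgle⟩
  have hpa : collapse τ l p ≠ a := by
    by_cases hpl : p ∈ l
    · rw [collapse_of_mem hpl]
      exact hτ0 p hpl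
    · rw [collapse_of_notMem hpl]
      rintro rfl
      have := h.one_le_part_fst he
      omega
  by_cases hqa : collapse τ l q = a
  · by_cases hql : q ∈ l
    · rw [collapse_of_mem hql] at hqa
      exact absurd hqa (hτ0 q hql)
    · rw [collapse_of_notMem hql] at hqa
      subst hqa
      have hp : p = s q := by
        rcases (h.mem_iff p q).mp he with ⟨-, h1⟩ | ⟨-, h1⟩
        · exact h1
        · omega
      subst hp
      rw [mapDomain_edgeExp, collapse_of_notMem hsl, collapse_of_notMem hql] at hle
      have h1 := (le_of_single_add_single_le hle).1
      rw [collapse_of_notMem hsl] at hpa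
      rw [Finsupp.add_apply, Finsupp.single_eq_of_ne hpa, add_zero] at h1
      exact ⟨g, hg, le_of_le_add_single hgle ((hsq g hg).trans h1)⟩
  · refine ⟨_, ⟨_, ⟨⟨p, q⟩, he, rfl⟩, rfl⟩, le_of_le_add_single hle ?_⟩
    rw [mapDomain_edgeExp, Finsupp.add_apply, Finsupp.single_eq_of_ne (Ne.symm hpa),
      Finsupp.single_eq_of_ne (Ne.symm hqa)]
    simp

/-- Identifying an unmatched vertex `b` of part `1` with a vertex of part `2` is a regular
operation. -/
lemma regular_unmatched (h : IsSecondClass P s w E) {b c : V} (hb : P b = 1) (hc : P c = 2)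
    (hbs : ∀ a, P a = 0 → s a ≠ b) {f : MvPolynomial V k}
    (hf : (X b - X c) * f ∈ monomialIdeal k (edgeExp w '' E)) :
    f ∈ monomialIdeal k (edgeExp w '' E) := by
  have hcb : c ≠ b := by
    rintro rfl
    omega
  have hf' : (X c - X b) * f ∈ monomialIdeal k (edgeExp w '' E) := by
    rw [← neg_sub, neg_mul]
    exact neg_mem hf
  refine mem_of_X_sub_X_mul_mem hcb ?_ ?_ hf'
  · rintro _ ⟨⟨p, q⟩, he, rfl⟩
    have hq : b ≠ q := fun hbq => h.part_snd_ne_one he (hbq ▸ hb)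
    rw [edgeExp, Finsupp.add_apply, Finsupp.single_eq_of_ne hq, Finsupp.single_apply]
    split_ifs <;> simp
  · rintro u ⟨_, ⟨⟨p, q⟩, he, rfl⟩, hle⟩ ⟨_, ⟨⟨p', q'⟩, he', rfl⟩, hle'⟩
    have hq'b : b ≠ q' := fun hbq => h.part_snd_ne_one he' (hbq ▸ hb)
    by_cases hp' : p' = b
    swap
    · refine ⟨_, ⟨_, he', rfl⟩, le_of_le_add_single hle' ?_⟩
      simp [edgeExp, Finsupp.single_eq_of_ne hq'b, Finsupp.single_eq_of_ne (Ne.symm hp')]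
    subst hp'
    have hq' : P q' = 2 := by
      rcases (h.mem_iff p' q').mp he' with ⟨h1, h2⟩ | ⟨-, h1⟩
      · exact absurd h2.symm (hbs q' h1)
      · omega
    have hu' : w q' ≤ u q' := by
      have := (le_of_single_add_single_le hle').2
      simpa [Finsupp.single_eq_of_ne hq'b.symm] using this
    by_cases hpc : p = c
    · subst hpc
      have hq : P q = 3 := by
        rcases (h.mem_iff p q).mp he with ⟨h1, h2⟩ | ⟨-, h1⟩
        · have := h.matching q h1
          rw [← h2] at this
          omega
        · omega
      have hqp : q ≠ p := by
        rintro rfl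
        omega
      have hu : w q ≤ u q := by
        have := (le_of_single_add_single_le hle).2
        simpa [Finsupp.single_eq_of_ne hqp] using this
      have hne : q' ≠ q := by
        rintro rfl
        omega
      exact ⟨_, ⟨(q', q), h.mem_of_part (by omega) (by omega), rfl⟩,
        single_add_single_le_of_ne hne ((h.weight_pos q').trans hu') hu⟩
    by_cases hqc : q = c
    · subst hqc
      have hp : P p = 1 := by
        rcases (h.mem_iff p q).mp he with ⟨h1, h2⟩ | ⟨-, h1⟩ <;> omega
      have hu : 1 ≤ u p := by
        have := (le_of_single_add_single_le hle).1
        simpa [Finsupp.single_eq_of_ne hpc] using this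
      have hne : p ≠ q' := by
        rintro rfl
        omega
      exact ⟨_, ⟨(p, q'), h.mem_of_part (by omega) (by omega), rfl⟩,
        single_add_single_le_of_ne hne hu hu'⟩
    · refine ⟨_, ⟨_, he, rfl⟩, le_of_le_add_single hle ?_⟩
      simp [edgeExp, Finsupp.single_eq_of_ne (Ne.symm hpc), Finsupp.single_eq_of_ne (Ne.symm hqc)]

variable [Fintype V]

/-- The depth of the edge ideal when every vertex of part `1` is matched. -/
theorem isGreatest_depthSet_of_matched (h : IsSecondClass P s w E) (hE : E.Nonempty)
    (hs : ∀ b, P b = 1 → ∃ a, P a = 0 ∧ s a = b) :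
    IsGreatest (depthSet k (edgeIdeal k E w)) (Finset.card {v : V | P v = 0} + 1) := by
  classical
  choose! t ht0 hts using hs
  have hst (a : V) (ha : P a = 0) : t (s a) = a :=
    h.matching_injOn _ _ (ht0 _ (h.matching a ha)) ha (hts _ (h.matching a ha))
  set l := (Finset.univ.filter fun v : V => P v = 0).toList with hl
  have hmem (v : V) : v ∈ l ↔ P v = 0 := by simp [hl]
  have hcl (v : V) (hv : P v ≠ 0) : collapse s l v = v :=
    collapse_of_notMem fun h' => hv ((hmem v).mp h')
  have hcl0 (v : V) (hv : P v = 0) : collapse s l v = s v := collapse_of_mem ((hmem v).mpr hv)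
  have hclE {p q : V} (he : (p, q) ∈ E) : collapse s l p = p :=
    hcl p (by have := h.one_le_part_fst he; omega)
  rw [edgeIdeal_eq_monomialIdeal, ← Finset.length_toList, ← hl]
  let u : V →₀ ℕ := Finsupp.equivFunOnFinite.symm fun v =>
    if P v = 0 then 0 else if P v = 1 then w (t v) else w v - 1
  have hu (v : V) : u v = if P v = 0 then 0 else if P v = 1 then w (t v) else w v - 1 := rfl
  have hus (a : V) (ha : P a = 0) : u (s a) = w a := by
    simp [hu, h.matching a ha, hst a ha]
  refine isGreatest_depthSet_of_collapse (hE.image _) h.zero_notMem (τ := s) (u := u)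
    (Finset.nodup_toList _) ?_ ?_ ?_ ?_ ?_
  · intro y hy hsy
    have := h.matching y ((hmem y).mp hy)
    rw [hmem] at hsy
    omega
  · intro i hi f hf
    refine h.regular_matching (fun v hv => Or.inl ⟨?_, rfl⟩)
      ((hmem _).mp (List.getElem_mem hi)) ?_ hf
    · exact (hmem v).mp (List.mem_of_mem_take hv)
    · intro hmem'
      obtain ⟨j, hj, hji⟩ := List.mem_take_iff_getElem.mp hmem'
      have := ((Finset.nodup_toList _).getElem_inj_iff).mp hji
      omega
  · intro y hy
    simp [hu, (hmem y).mp hy]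
  · rintro _ ⟨⟨p, q⟩, he, rfl⟩ hle
    rw [mapDomain_edgeExp, hclE he] at hle
    rcases (h.mem_iff p q).mp he with ⟨hq, rfl⟩ | ⟨hp, hq⟩
    · rw [hcl0 q hq] at hle
      have := succ_le_of_single_add_single_le hle
      rw [hus q hq] at this
      omega
    · rw [hcl q (by omega)] at hle
      have := (le_of_single_add_single_le hle).2
      have hw := h.weight_pos q
      rw [hu, if_neg (by omega), if_neg (by omega)] at this
      omega
  · intro x hx
    rw [hmem] at hx
    obtain hx1 | hx2 : P x = 1 ∨ 2 ≤ P x := by omega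
    · refine ⟨_, ⟨_, h.mem_matching (ht0 x hx1), rfl⟩, ?_⟩
      rw [mapDomain_edgeExp, hclE (h.mem_matching (ht0 x hx1)), hcl0 _ (ht0 x hx1), hts x hx1]
      refine single_add_single_le_of_eq ?_
      simp [hu, hx1]
    · obtain ⟨p, hp⟩ := h.exists_part x (P x - 1) (by omega)
      have he := h.mem_of_part (p := p) (q := x) (by omega) (by omega)
      refine ⟨_, ⟨_, he, rfl⟩, ?_⟩
      rw [mapDomain_edgeExp, hclE he, hcl x hx]
      have hpx : p ≠ x := by
        rintro rfl
        omega
      have hwx := h.weight_pos x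
      refine single_add_single_le_of_ne hpx ?_ ?_
      · rw [Finsupp.add_apply, Finsupp.single_eq_of_ne hpx, hu, if_neg (by omega)]
        split_ifs with hp1
        · exact h.weight_pos _
        · have := h.two_le_weight p x (by omega) (by omega)
          omega
      · rw [Finsupp.add_apply, Finsupp.single_eq_same, hu, if_neg (by omega), if_neg (by omega)]
        omega

/-- The depth of the edge ideal when some vertex of part `1` is unmatched. -/
theorem isGreatest_depthSet_of_unmatched (h : IsSecondClass P s w E) {b c : V} (hb : P b = 1)
    (hc : P c = 2) (hbs : ∀ a, P a = 0 → s a ≠ b) :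
    IsGreatest (depthSet k (edgeIdeal k E w)) (Finset.card {v : V | P v = 0} + 2) := by
  classical
  let τ : V → V := fun v => if P v = 0 then s v else c
  have hτ0 (v : V) (hv : P v = 0) : τ v = s v := if_pos hv
  have hτb : τ b = c := if_neg (by omega)
  set l := b :: (Finset.univ.filter fun v : V => P v = 0).toList with hl
  have hlen : l.length = Finset.card {v : V | P v = 0} + 1 := by simp [hl]
  have hmem (v : V) : v ∈ l ↔ v = b ∨ P v = 0 := by simp [hl]
  have hnd : l.Nodup := List.nodup_cons.mpr ⟨by simp [hb], Finset.nodup_toList _⟩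
  have hcb : c ≠ b := by
    rintro rfl
    omega
  have hclb : collapse τ l b = c := by rw [collapse_of_mem ((hmem b).mpr (Or.inl rfl)), hτb]
  have hcl (v : V) (hvb : v ≠ b) (hv : P v ≠ 0) : collapse τ l v = v :=
    collapse_of_notMem fun h' => ((hmem v).mp h').elim hvb hv
  have hcl2 (v : V) (hv : 2 ≤ P v) : collapse τ l v = v := by
    refine hcl v ?_ (by omega)
    rintro rfl
    omega
  rw [edgeIdeal_eq_monomialIdeal, ← add_assoc (_ : ℕ) 1 1, ← hlen]
  let u : V →₀ ℕ := Finsupp.equivFunOnFinite.symm fun v =>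
    if P v ≤ 1 then 0 else if v = c then w v else w v - 1
  have hu (v : V) : u v = if P v ≤ 1 then 0 else if v = c then w v else w v - 1 := rfl
  have huc : u c = w c := by simp [hu, hc]
  have hu2 (v : V) (hv : 2 ≤ P v) (hvc : v ≠ c) : u v = w v - 1 := by
    rw [hu, if_neg (by omega), if_neg hvc]
  have hu1 (v : V) (hv : P v ≤ 1) : u v = 0 := if_pos hv
  have hwc := h.weight_pos c
  have hE : E.Nonempty := ⟨(b, c), h.mem_of_part (by omega) (by omega)⟩
  refine isGreatest_depthSet_of_collapse (hE.image _) h.zero_notMem (τ := τ) (u := u) hnd ?_ ?_ ?_ ?_ ?_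
  · intro y hy hτy
    rcases (hmem y).mp hy with rfl | hy0
    · rw [hτb, hmem] at hτy
      exact hτy.elim hcb (by omega)
    · rw [hτ0 y hy0, hmem] at hτy
      have := h.matching y hy0
      exact hτy.elim (hbs y hy0) (by omega)
  · intro i hi f hf
    cases i with
    | zero =>
      have hid : Finsupp.mapDomain (collapse τ (l.take 0)) '' (edgeExp w '' E) =
          edgeExp w '' E := by
        have : collapse τ (l.take 0) = id := funext fun v => collapse_of_notMem (by simp)
        rw [this, show (Finsupp.mapDomain (id : V → V) : (V →₀ ℕ) → _) = id from
          funext fun _ => Finsupp.mapDomain_id, Set.image_id]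
      rw [hid] at hf ⊢
      simp only [hl, List.getElem_cons_zero, hτb] at hf
      exact h.regular_unmatched hb hc hbs hf
    | succ i =>
      have hP : P l[i + 1] = 0 := by
        have : l[i + 1] ∈ (Finset.univ.filter fun v : V => P v = 0).toList := by
          simp only [hl, List.getElem_cons_succ]
          exact List.getElem_mem _
        simpa using this
      rw [hτ0 _ hP] at hf
      refine h.regular_matching (fun v hv => ?_) hP ?_ hf
      · rcases (hmem v).mp (List.mem_of_mem_take hv) with rfl | hv0
        · exact Or.inr ⟨by rw [hτb, hc], hbs⟩
        · exact Or.inl ⟨hv0, hτ0 v hv0⟩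
      · intro hmem'
        obtain ⟨j, hj, hji⟩ := List.mem_take_iff_getElem.mp hmem'
        have := (hnd.getElem_inj_iff).mp hji
        omega
  · intro y hy
    refine hu1 y ?_
    rcases (hmem y).mp hy with rfl | hy0 <;> omega
  · rintro _ ⟨⟨p, q⟩, he, rfl⟩ hle
    rw [mapDomain_edgeExp] at hle
    have hp1 := h.one_le_part_fst he
    obtain ⟨hle1, hle2⟩ := le_of_single_add_single_le hle
    have hp : p = b ∨ 2 ≤ P p := by
      by_contra! hp
      rw [hcl p hp.1 (by omega), hu1 p (by omega)] at hle1
      omega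
    have hq : P q = P p + 1 := by
      rcases (h.mem_iff p q).mp he with ⟨hq, rfl⟩ | ⟨-, hq⟩
      · have := h.matching q hq
        exact (hp.elim (hbs q hq) (by omega)).elim
      · exact hq
    have hwq := h.weight_pos q
    rw [hcl2 q (by omega)] at hle2
    rcases eq_or_ne q c with rfl | hqc
    · obtain rfl : p = b := hp.resolve_right (by omega)
      rw [hclb, hcl2 q (by omega)] at hle
      have := succ_le_of_single_add_single_le hle
      omega
    · rw [hu2 q (by omega) hqc] at hle2
      omega
  · intro x hx
    rw [hmem, not_or] at hx
    have hwx := h.weight_pos x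
    rcases eq_or_ne x c with rfl | hxc
    · refine ⟨_, ⟨_, h.mem_of_part (p := b) (q := x) (by omega) (by omega), rfl⟩, ?_⟩
      rw [mapDomain_edgeExp, hclb, hcl2 x (by omega)]
      refine single_add_single_le_of_eq ?_
      simp [huc]
    obtain hx1 | hx2 | hx3 : P x = 1 ∨ P x = 2 ∨ 3 ≤ P x := by omega
    · refine ⟨_, ⟨_, h.mem_of_part (p := x) (q := c) (by omega) (by omega), rfl⟩, ?_⟩
      rw [mapDomain_edgeExp, hcl x hx.1 hx.2, hcl2 c (by omega)]
      refine single_add_single_le_of_ne hxc ?_ ?_ <;> simp [huc]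
    · refine ⟨_, ⟨_, h.mem_of_part (p := b) (q := x) (by omega) (by omega), rfl⟩, ?_⟩
      rw [mapDomain_edgeExp, hclb, hcl2 x (by omega)]
      refine single_add_single_le_of_ne hxc.symm ?_ ?_
      · simp only [Finsupp.add_apply, huc]
        omega
      · simp only [Finsupp.add_apply, hu2 x (by omega) hxc, Finsupp.single_eq_same]
        omega
    · obtain ⟨p, hp⟩ := h.exists_part x (P x - 1) (by omega)
      have hpx : p ≠ x := by
        rintro rfl
        omega
      refine ⟨_, ⟨_, h.mem_of_part (p := p) (q := x) (by omega) (by omega), rfl⟩, ?_⟩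
      rw [mapDomain_edgeExp, hcl2 p (by omega), hcl2 x (by omega)]
      refine single_add_single_le_of_ne hpx ?_ ?_
      · have := h.two_le_weight p x (by omega) (by omega)
        rw [Finsupp.add_apply, hu, if_neg (by omega)]
        split_ifs <;> omega
      · simp only [Finsupp.add_apply, hu2 x (by omega) hxc, Finsupp.single_eq_same]
        omega

end IsSecondClass

end SecondClass

end WOG

/-- **Theorem (second class, regularity).**
`D` is a vertex-weighted oriented `m`-partite graph (`m ≥ 2`) of the second
class: the vertex set is partitioned into nonempty parts `V_1, …, V_m`
(encoded by `part : V → Fin m`, with `|V_1| ≤ |V_2|`); `D_1` is a matching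
pairing each vertex `a ∈ V_1` with a distinct vertex `σ a ∈ V_2`, its edges
directed from `V_2` to `V_1`; and for `2 ≤ i ≤ m-1` the edges between `V_i`
and `V_{i+1}` form a complete bipartite graph directed from `V_i` to
`V_{i+1}`.  `D` has no isolated vertices, sources have weight `1`, and
non-source vertices outside `V_1 ⊔ V_m` have weight `≥ 2`.
Then `depth I(D) = |V_1| + 2` if `|V_1| < |V_2|`, and
`depth I(D) = |V_2| + 1` if `|V_1| = |V_2|`. -/
theorem second_class_depth (k : Type) [Field k] (m : ℕ) (hm : 2 ≤ m)
    (V : Type) [Fintype V] (part : V → Fin m) (hpart : ∀ i : Fin m, ∃ x : V, part x = i)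
    (ht : Nat.card {x : V // (part x : ℕ) = 0} ≤ Nat.card {x : V // (part x : ℕ) = 1})
    (σ : {x : V // (part x : ℕ) = 0} → V) (hσinj : Function.Injective σ)
    (hσ : ∀ a, (part (σ a) : ℕ) = 1)
    (E : Set (V × V))
    (hE : E = {p : V × V |
      (∃ a : {x : V // (part x : ℕ) = 0}, p.1 = σ a ∧ p.2 = (a : V)) ∨
      (1 ≤ (part p.1 : ℕ) ∧ (part p.2 : ℕ) = (part p.1 : ℕ) + 1)})
    (hiso : ∀ x : V, ∃ y : V, (x, y) ∈ E ∨ (y, x) ∈ E)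
    (w : V → ℕ) (hw : ∀ x : V, 1 ≤ w x)
    (hsrc : ∀ x : V, (∀ y : V, (y, x) ∉ E) → w x = 1)
    (hw2 : ∀ x : V, (∃ y : V, (y, x) ∈ E) →
      (part x : ℕ) ≠ 0 → (part x : ℕ) ≠ m - 1 → 2 ≤ w x)
    :
    (Nat.card {x : V // (part x : ℕ) = 0} < Nat.card {x : V // (part x : ℕ) = 1} →
      IsGreatest (WOG.depthSet k (WOG.edgeIdeal k E w))
        (Nat.card {x : V // (part x : ℕ) = 0} + 2)) ∧
    (Nat.card {x : V // (part x : ℕ) = 0} = Nat.card {x : V // (part x : ℕ) = 1} →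
      IsGreatest (WOG.depthSet k (WOG.edgeIdeal k E w))
        (Nat.card {x : V // (part x : ℕ) = 1} + 1)) := by
  classical
  subst hE
  set P : V → ℕ := fun v => part v with hP
  set s : V → V := fun v => if h : P v = 0 then σ ⟨v, h⟩ else v with hs
  have hs0 (v : V) (h : P v = 0) : s v = σ ⟨v, h⟩ := dif_pos h
  have hexists (x : V) (n : ℕ) (hn : n ≤ P x) : ∃ v, P v = n := by
    obtain ⟨v, hv⟩ := hpart ⟨n, hn.trans_lt (part x).isLt⟩
    exact ⟨v, congrArg Fin.val hv⟩
  set E : Set (V × V) := {p : V × V |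
      (∃ a : {x : V // (part x : ℕ) = 0}, p.1 = σ a ∧ p.2 = (a : V)) ∨
      (1 ≤ (part p.1 : ℕ) ∧ (part p.2 : ℕ) = (part p.1 : ℕ) + 1)} with hE
  have hmem (p q : V) : (p, q) ∈ E ↔ (P q = 0 ∧ p = s q) ∨ (1 ≤ P p ∧ P q = P p + 1) := by
    refine or_congr ⟨?_, ?_⟩ Iff.rfl
    · rintro ⟨a, h1, h2⟩
      obtain rfl : q = a := h2
      exact ⟨a.2, by rw [hs0 _ a.2]; exact h1⟩
    · rintro ⟨h1, h2⟩
      exact ⟨⟨q, h1⟩, h2.trans (hs0 q h1), rfl⟩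
  have h : WOG.IsSecondClass P s w E :=
    { mem_iff := hmem
      matching := fun v hv => by rw [hs0 v hv]; exact hσ _
      matching_injOn := fun v v' hv hv' heq => by
        rw [hs0 v hv, hs0 v' hv'] at heq
        exact congrArg Subtype.val (hσinj heq)
      exists_part := hexists
      weight_pos := hw
      two_le_weight := fun v x hv hx => by
        obtain ⟨y, hy⟩ := hexists v (P v - 1) (by omega)
        have hxm : P x < m := (part x).isLt
        refine hw2 v ⟨y, (hmem y v).mpr (Or.inr ⟨by omega, by omega⟩)⟩ ?_ ?_
        · change P v ≠ 0
          omega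
        · change P v ≠ m - 1
          omega }
  have hcard : Nat.card {x : V // (part x : ℕ) = 0} = Finset.card {v : V | P v = 0} := by
    rw [Nat.card_eq_fintype_card, Fintype.card_subtype]
  let g : {x : V // (part x : ℕ) = 0} → {x : V // (part x : ℕ) = 1} := fun a => ⟨σ a, hσ a⟩
  have hg : Function.Injective g := fun a a' haa' => hσinj (congrArg Subtype.val haa')
  refine ⟨fun hlt => ?_, fun heq => ?_⟩
  · have hgs : ¬ Function.Surjective g := fun hgs =>
      hlt.ne (Nat.card_eq_of_bijective g ⟨hg, hgs⟩)
    simp only [Function.Surjective, not_forall, not_exists] at hgs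
    obtain ⟨⟨b, hb⟩, hbg⟩ := hgs
    have hbs (a : V) (ha : P a = 0) : s a ≠ b := by
      intro hab
      rw [hs0 a ha] at hab
      exact hbg ⟨a, ha⟩ (Subtype.ext hab)
    obtain ⟨c, hc⟩ : ∃ c, P c = 2 := by
      have hb' : P b = 1 := hb
      obtain ⟨c, hc | hc⟩ := hiso b
      · rcases (hmem b c).mp hc with ⟨h0, h1⟩ | ⟨-, h1⟩
        · exact absurd h1.symm (hbs c h0)
        · exact ⟨c, by omega⟩
      · rcases (hmem c b).mp hc with ⟨h0, -⟩ | ⟨h0, h1⟩ <;> omega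
    rw [hcard]
    exact h.isGreatest_depthSet_of_unmatched hb hc hbs
  · have hgs : Function.Surjective g :=
      ((Nat.bijective_iff_injective_and_card g).mpr ⟨hg, heq⟩).2
    rw [← heq, hcard]
    refine h.isGreatest_depthSet_of_matched ?_ fun b hb => ?_
    · obtain ⟨x, -⟩ := hpart ⟨0, by omega⟩
      obtain ⟨y, hy | hy⟩ := hiso x
      exacts [⟨_, hy⟩, ⟨_, hy⟩]
    · obtain ⟨a, ha⟩ := hgs ⟨b, hb⟩
      refine ⟨a, a.2, ?_⟩
      rw [hs0 _ a.2]
      exact congrArg Subtype.val ha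
end
end

section
/- Let m ≥ 3 be an integer and let D = (V,E,w) be a vertex-weighted oriented m-partite graph of the third class (with m parts). Assume w(x) ≥ 2 for all x ∈ V. Then the Castelnuovo–Mumford regularity of the edge ideal satisfies reg(I(D)) = (Σ_{x ∈ V} w(x)) − |V| + 1. -/
open MvPolynomial

noncomputable section

namespace Koszul

section Chains

variable {V : Type} [LinearOrder V]

/-- The sign of `v ∧ τ`: the parity of the number of elements of `τ` below `v`. -/
def sgn (v : V) (τ : Finset V) : ℤ := (-1) ^ (τ.filter (· < v)).card

lemma sgn_mul_self (v : V) (τ : Finset V) : sgn v τ * sgn v τ = 1 := by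
  rw [sgn, ← mul_pow]; norm_num

lemma sgn_insert_of_lt {u v : V} (h : u < v) {τ : Finset V} (hu : u ∉ τ) :
    sgn v (insert u τ) = -sgn v τ := by
  rw [sgn, sgn, Finset.filter_insert, if_pos h, Finset.card_insert_of_notMem (by simp [hu]),
    pow_succ, mul_neg_one]

lemma sgn_insert_of_not_lt {u v : V} (h : ¬ u < v) (τ : Finset V) :
    sgn v (insert u τ) = sgn v τ := by
  rw [sgn, sgn, Finset.filter_insert, if_neg h]

lemma sgn_mul_sgn_insert {u v : V} (huv : u ≠ v) {τ : Finset V} (hu : u ∉ τ) (hv : v ∉ τ) :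
    sgn u τ * sgn v (insert u τ) = -(sgn v τ * sgn u (insert v τ)) := by
  rcases huv.lt_or_gt with h | h
  · rw [sgn_insert_of_lt h hu, sgn_insert_of_not_lt h.not_gt]; ring
  · rw [sgn_insert_of_lt h hv, sgn_insert_of_not_lt h.not_gt]; ring

variable {R : Type*} [CommRing R] {M N : Type*} [AddCommGroup M] [Module R M]
  [AddCommGroup N] [Module R N]

/-- Contraction of a Koszul chain with the basis vector `v`. -/
def contract (R : Type*) [CommRing R] {M : Type*} [AddCommGroup M] [Module R M] (v : V) :
    (Finset V → M) →ₗ[R] (Finset V → M) where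
  toFun f τ := if v ∈ τ then 0 else sgn v τ • f (insert v τ)
  map_add' f g := by
    ext τ; by_cases h : v ∈ τ <;> simp [h]
  map_smul' r f := by
    ext τ
    by_cases h : v ∈ τ
    · simp [h]
    · simpa [h] using smul_comm _ _ _

lemma contract_apply (v : V) (f : Finset V → M) (τ : Finset V) :
    contract R v f τ = if v ∈ τ then 0 else sgn v τ • f (insert v τ) := rfl

lemma contract_self (v : V) (f : Finset V → M) : contract R v (contract R v f) = 0 := by
  ext τ; simp [contract_apply]

lemma contract_swap (u v : V) (f : Finset V → M) :
    contract R u (contract R v f) = -contract R v (contract R u f) := by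
  rcases eq_or_ne u v with rfl | huv
  · simp [contract_self]
  ext τ
  simp only [contract_apply, Pi.neg_apply, Finset.mem_insert]
  by_cases hu : u ∈ τ <;> by_cases hv : v ∈ τ <;> simp [hu, hv, huv, huv.symm]
  rw [smul_smul, smul_smul, sgn_mul_sgn_insert huv hu hv, neg_smul, Finset.insert_comm]

/-- Exterior multiplication of a chain by the basis vector `v`. -/
def wedge (v : V) (f : Finset V → M) (τ : Finset V) : M :=
  if v ∈ τ then sgn v (τ.erase v) • f (τ.erase v) else 0

lemma contract_wedge_self (v : V) (f : Finset V → M) :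
    contract R v (wedge v f) + wedge v (contract R v f) = f := by
  ext τ
  simp only [contract_apply, wedge, Pi.add_apply]
  by_cases hv : v ∈ τ
  · simp [hv, smul_smul, sgn_mul_self]
  · simp [hv, smul_smul, sgn_mul_self]

lemma contract_wedge {u v : V} (huv : u ≠ v) (f : Finset V → M) :
    contract R u (wedge v f) + wedge v (contract R u f) = 0 := by
  ext τ
  simp only [contract_apply, wedge, Pi.add_apply, Finset.mem_insert, Finset.mem_erase]
  by_cases hu : u ∈ τ <;> by_cases hv : v ∈ τ <;> simp [hu, hv, huv, huv.symm]
  obtain ⟨σ, hσ, rfl⟩ : ∃ σ, v ∉ σ ∧ insert v σ = τ :=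
    ⟨τ.erase v, by simp, Finset.insert_erase hv⟩
  have huσ : u ∉ σ := fun h => hu (Finset.mem_insert_of_mem h)
  rw [Finset.insert_comm, Finset.erase_insert (by simp [hσ, huv.symm]), Finset.erase_insert hσ,
    smul_smul, smul_smul, mul_comm (sgn u _), mul_comm (sgn v σ)]
  have h := sgn_mul_sgn_insert huv huσ hσ
  have : sgn v (insert u σ) * sgn u (insert v σ) = -(sgn u σ * sgn v σ) := by
    have h1 := sgn_mul_self u σ
    have h2 := sgn_mul_self u (insert v σ)
    linear_combination (-sgn u σ * sgn v σ) * h2 + (sgn u σ * sgn u (insert v σ)) * h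
      - (sgn v (insert u σ) * sgn u (insert v σ)) * h1
  rw [this, neg_smul, neg_add_cancel]

variable [Fintype V]

/-- The Koszul-type differential attached to the coefficients `x`. -/
def bdry (x : V → R) : (Finset V → M) →ₗ[R] (Finset V → M) :=
  ∑ v, x v • contract R v

lemma bdry_apply (x : V → R) (f : Finset V → M) (τ : Finset V) :
    bdry x f τ = ∑ v, x v • contract R v f τ := by
  simp [bdry]

lemma bdry_bdry (x : V → R) (f : Finset V → M) : bdry x (bdry x f) = 0 := by
  have h : bdry x (bdry x f) =
      ∑ p : V × V, (x p.1 * x p.2) • contract R p.2 (contract R p.1 f) := by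
    simp [bdry, Fintype.sum_prod_type, Finset.smul_sum, smul_smul]
  rw [h]
  refine Finset.sum_involution (fun p _ => p.swap) ?_ ?_ (by simp) (by simp)
  · rintro ⟨u, v⟩ -
    simp only [Prod.swap]
    rw [contract_swap v u, mul_comm, smul_neg, neg_add_cancel]
  · rintro ⟨u, v⟩ - hne heq
    obtain rfl : v = u := by simpa using congrArg Prod.fst heq
    simp [contract_self] at hne

lemma bdry_wedge (v : V) (f : Finset V → M) :
    bdry (1 : V → R) (wedge v f) + wedge v (bdry (1 : V → R) f) = f := by
  have h : wedge v (bdry (1 : V → R) f) = ∑ u, wedge v (contract R u f) := by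
    ext τ
    by_cases hv : v ∈ τ <;> simp [wedge, hv, bdry, Finset.smul_sum]
  rw [h, bdry]
  simp only [Pi.one_apply, one_smul, LinearMap.sum_apply, ← Finset.sum_add_distrib]
  rw [Finset.sum_eq_single v (fun u _ hu => contract_wedge hu f) (by simp)]
  exact contract_wedge_self v f

lemma bdry_comp (x : V → R) (δ : M →ₗ[R] N) (f : Finset V → M) (τ : Finset V) :
    bdry x (fun σ => δ (f σ)) τ = δ (bdry x f τ) := by
  simp only [bdry_apply, map_sum, map_smul, contract_apply, apply_ite δ, map_zero, map_zsmul]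

lemma bdry_mem {x : V → R} {Z : Submodule R M} {f : Finset V → M} (hf : ∀ τ, f τ ∈ Z)
    (τ : Finset V) : bdry x f τ ∈ Z := by
  rw [bdry_apply]
  refine Z.sum_mem fun v _ => Z.smul_mem _ ?_
  rw [contract_apply]
  split_ifs
  · exact Z.zero_mem
  · exact zsmul_mem (hf _) _

end Chains

end Koszul

namespace Koszul

variable {k : Type} [Field k] {V : Type}

section Components

/-- The homogeneous component of a polynomial, with integer degrees allowed. -/
def polyComp (n : ℤ) (p : MvPolynomial V k) : MvPolynomial V k :=
  if 0 ≤ n then homogeneousComponent n.toNat p else 0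

lemma coeff_polyComp (n : ℤ) (p : MvPolynomial V k) (d : V →₀ ℕ) :
    coeff d (polyComp n p) = if (d.degree : ℤ) = n then coeff d p else 0 := by
  unfold polyComp
  split_ifs with h1 h2 h2
  · rw [coeff_homogeneousComponent, if_pos (by omega)]
  · rw [coeff_homogeneousComponent, if_neg (by omega)]
  · omega
  · simp

lemma polyComp_mul {q : MvPolynomial V k} {e : ℕ} (hq : q.IsHomogeneous e) (n : ℤ)
    (p : MvPolynomial V k) : polyComp (n + e) (q * p) = q * polyComp n p := by
  classical
  ext d
  rw [coeff_polyComp, coeff_mul, coeff_mul]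
  have key : ∀ x ∈ Finset.HasAntidiagonal.antidiagonal d, coeff x.1 q * coeff x.2 (polyComp n p) =
      if (d.degree : ℤ) = n + e then coeff x.1 q * coeff x.2 p else 0 := by
    rintro ⟨a, b⟩ hx
    rw [Finset.HasAntidiagonal.mem_antidiagonal] at hx
    by_cases ha : a.degree = e
    · have hd : d.degree = a.degree + b.degree := by rw [← hx, map_add]
      simp only [coeff_polyComp, mul_ite, mul_zero]
      exact if_congr (by omega) rfl rfl
    · simp [hq.coeff_eq_zero ha]
  rw [Finset.sum_congr rfl key]
  split_ifs <;> simp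

lemma polyComp_add (n : ℤ) (p q : MvPolynomial V k) :
    polyComp n (p + q) = polyComp n p + polyComp n q := by
  ext d; simp only [coeff_polyComp, coeff_add]; split_ifs <;> simp

lemma polyComp_zero (n : ℤ) : polyComp n (0 : MvPolynomial V k) = 0 := by
  ext d; simp [coeff_polyComp]

lemma polyComp_polyComp (n : ℤ) (p : MvPolynomial V k) :
    polyComp n (polyComp n p) = polyComp n p := by
  ext d; simp only [coeff_polyComp]; split_ifs <;> rfl

lemma polyComp_of_isHomogeneous {p : MvPolynomial V k} {e : ℕ} (hp : p.IsHomogeneous e) :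
    polyComp e p = p := by
  ext d
  rw [coeff_polyComp]
  split_ifs with h
  · rfl
  · exact (hp.coeff_eq_zero (by exact_mod_cast h)).symm

lemma polyComp_X_mul (n : ℤ) (v : V) (p : MvPolynomial V k) :
    polyComp (n + 1) (X v * p) = X v * polyComp n p := by
  simpa using polyComp_mul (isHomogeneous_X k v) n p

/-- A family of degree projections on a module over the polynomial ring,
shifted by one under multiplication with a variable. -/
structure Grading (k V M : Type) [Field k] [AddCommGroup M] [Module (MvPolynomial V k) M] where
  comp : ℤ → M →+ M
  comp_X : ∀ n (v : V) m,
    comp (n + 1) ((X v : MvPolynomial V k) • m) = (X v : MvPolynomial V k) • comp n m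
  comp_comp : ∀ n m, comp n (comp n m) = comp n m

/-- The standard grading of the polynomial ring. -/
def polyGrading (k V : Type) [Field k] : Grading k V (MvPolynomial V k) where
  comp n := ⟨⟨polyComp n, polyComp_zero n⟩, polyComp_add n⟩
  comp_X n v p := polyComp_X_mul n v p
  comp_comp n p := polyComp_polyComp n p

@[simp] lemma polyGrading_comp (n : ℤ) (p : MvPolynomial V k) :
    (polyGrading k V).comp n p = polyComp n p := rfl

/-- The grading of the free module with basis `ι` in degrees `deg`. -/
def freeGrading (k V : Type) [Field k] {ι : Type} (deg : ι → ℕ) :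
    Grading k V (ι →₀ MvPolynomial V k) where
  comp n :=
    { toFun := fun f => Finsupp.onFinset f.support (fun b => polyComp (n - deg b) (f b))
        (fun b hb => by
          rw [Finsupp.mem_support_iff]
          intro h
          exact hb (by rw [h, polyComp_zero]))
      map_zero' := by ext1 b; simp [polyComp_zero]
      map_add' := fun f g => by ext1 b; simp [polyComp_add] }
  comp_X n v f := by
    ext1 b
    simp only [AddMonoidHom.coe_mk, ZeroHom.coe_mk, Finsupp.onFinset_apply, Finsupp.smul_apply,
      smul_eq_mul]
    rw [← polyComp_X_mul]
    congr 1; ring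
  comp_comp n f := by ext1 b; simp [polyComp_polyComp]

@[simp] lemma freeGrading_comp_apply {ι : Type} (deg : ι → ℕ) (n : ℤ)
    (f : ι →₀ MvPolynomial V k) (b : ι) :
    (freeGrading k V deg).comp n f b = polyComp (n - deg b) (f b) := rfl

lemma freeGrading_comp_single {ι : Type} (deg : ι → ℕ) (n : ℤ) (a : ι) (p : MvPolynomial V k) :
    (freeGrading k V deg).comp n (Finsupp.single a p) =
      Finsupp.single a (polyComp (n - deg a) p) := by
  ext1 b
  rcases eq_or_ne a b with rfl | h
  · simp
  · simp [Finsupp.single_eq_of_ne h.symm, polyComp_zero]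

end Components

section Acyclicity

variable [LinearOrder V]

/-- The exponent vector of the squarefree monomial on `τ`. -/
def expo (τ : Finset V) : V →₀ ℕ := Finsupp.indicator τ fun _ _ => 1

lemma expo_apply (τ : Finset V) (v : V) : expo τ v = if v ∈ τ then 1 else 0 := by
  simp [expo, Finsupp.indicator_apply]

lemma expo_insert {τ : Finset V} {v : V} (hv : v ∉ τ) :
    expo (insert v τ) = expo τ + Finsupp.single v 1 := by
  ext u
  rcases eq_or_ne u v with rfl | h
  · simp [expo_apply, hv]
  · simp [expo_apply, h]

/-- The Koszul chain of multidegree `a` with given scalars. -/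
def monoChain (a : V →₀ ℕ) (c : Finset V → k) (τ : Finset V) : MvPolynomial V k :=
  if expo τ ≤ a then monomial (a - expo τ) (c τ) else 0

/-- The scalars of the component of multidegree `a` of a Koszul chain. -/
def coeffChain (a : V →₀ ℕ) (f : Finset V → MvPolynomial V k) (τ : Finset V) : k :=
  if expo τ ≤ a then coeff (a - expo τ) (f τ) else 0

variable [Fintype V]

/-- The Koszul differential of the variables. -/
abbrev dK (k : Type) [Field k] {V : Type} [Fintype V] [LinearOrder V] {M : Type}
    [AddCommGroup M] [Module (MvPolynomial V k) M] :
    (Finset V → M) →ₗ[MvPolynomial V k] (Finset V → M) :=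
  bdry (X : V → MvPolynomial V k)

lemma dK_monoChain (a : V →₀ ℕ) (c : Finset V → k) (hc : ∀ τ, ¬ expo τ ≤ a → c τ = 0) :
    dK k (monoChain a c) = monoChain a (bdry (1 : V → k) c) := by
  ext1 τ
  have key : ∀ v, (X v : MvPolynomial V k) • contract (MvPolynomial V k) v (monoChain a c) τ =
      if expo τ ≤ a then monomial (a - expo τ) (contract k v c τ) else 0 := by
    intro v
    simp only [contract_apply]
    by_cases hv : v ∈ τ
    · simp [hv]
    simp only [hv, if_false, monoChain]
    by_cases h : expo (insert v τ) ≤ a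
    · have h' : expo τ ≤ a := le_trans (by rw [expo_insert hv]; exact le_self_add) h
      have h2 : a - expo τ = Finsupp.single v 1 + (a - expo (insert v τ)) := by
        rw [expo_insert hv] at h ⊢
        rw [← tsub_tsub, add_tsub_cancel_of_le]
        exact le_tsub_of_add_le_left h
      rw [if_pos h, if_pos h', h2, X, smul_comm, smul_eq_mul, monomial_mul, one_mul, map_zsmul]
    · rw [if_neg h, hc _ h]
      simp
  rw [bdry_apply, Finset.sum_congr rfl fun v _ => key v, monoChain, bdry_apply]
  split_ifs <;> simp

lemma coeffChain_dK (a : V →₀ ℕ) (f : Finset V → MvPolynomial V k) :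
    coeffChain a (dK k f) = bdry (1 : V → k) (coeffChain a f) := by
  ext τ
  have key : ∀ v, contract k v (coeffChain a f) τ = if expo τ ≤ a then
      coeff (a - expo τ) ((X v : MvPolynomial V k) • contract (MvPolynomial V k) v f τ) else 0 := by
    intro v
    simp only [contract_apply]
    by_cases hv : v ∈ τ
    · simp [hv]
    simp only [hv, if_false, coeffChain, smul_eq_mul, mul_smul_comm]
    by_cases h : expo (insert v τ) ≤ a
    · have h' : expo τ ≤ a := le_trans (by rw [expo_insert hv]; exact le_self_add) h
      have h2 : a - expo τ = Finsupp.single v 1 + (a - expo (insert v τ)) := by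
        rw [expo_insert hv] at h ⊢
        rw [← tsub_tsub, add_tsub_cancel_of_le]
        exact le_tsub_of_add_le_left h
      rw [if_pos h, if_pos h', h2, coeff_smul, coeff_X_mul]
    · rw [if_neg h, smul_zero]
      split_ifs with h'
      · rw [coeff_smul, coeff_X_mul', if_neg, smul_zero]
        contrapose! h
        rw [expo_insert hv]
        intro u
        have := h' u
        rcases eq_or_ne u v with rfl | huv
        · simp at h ⊢; omega
        · simpa [huv.symm, huv] using this
      · rfl
  rw [bdry_apply, coeffChain, bdry_apply, coeff_sum]
  simp only [key, Pi.one_apply, one_smul]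
  split_ifs <;> simp

lemma poly_acyclic (f : Finset V → MvPolynomial V k) (hf : dK k f = 0)
    (h0 : constantCoeff (f ∅) = 0) : ∃ g, dK k g = f := by
  classical
  set A : Finset (V →₀ ℕ) :=
    (Finset.univ : Finset (Finset V)).biUnion fun τ => (f τ).support.image (· + expo τ) with hA
  have hne : ∀ a : V →₀ ℕ, a ≠ 0 → ∃ v, a v ≠ 0 := fun a ha => by
    simpa using Finsupp.ne_iff.mp ha
  have hfA : f = ∑ a ∈ A, monoChain a (coeffChain a f) := by
    ext τ b
    rw [Finset.sum_apply, coeff_sum]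
    have key : ∀ a ∈ A, coeff b (monoChain a (coeffChain a f) τ) =
        if a = b + expo τ then coeff b (f τ) else 0 := by
      intro a _
      unfold monoChain coeffChain
      split_ifs with h1 h2 h2
      · subst h2; simp
      · rw [coeff_monomial, if_neg]
        rintro rfl
        exact h2 (tsub_add_cancel_of_le h1).symm
      · subst h2; exact absurd le_add_self h1
      · simp
    rw [Finset.sum_congr rfl key, Finset.sum_ite_eq']
    split_ifs with h
    · rfl
    · by_contra hb
      exact h (Finset.mem_biUnion.mpr ⟨τ, Finset.mem_univ _,
        Finset.mem_image_of_mem _ (mem_support_iff.mpr hb)⟩)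
  have hpart : ∀ a : V →₀ ℕ, ∃ g, dK k g = monoChain a (coeffChain a f) := by
    intro a
    by_cases ha : a = 0
    · refine ⟨0, ?_⟩
      subst ha
      rw [map_zero]
      ext1 τ
      unfold monoChain coeffChain
      split_ifs with h
      · have : τ = ∅ := by
          by_contra hτ
          obtain ⟨v, hv⟩ := Finset.nonempty_iff_ne_empty.mpr hτ
          have := h v
          simp [expo_apply, hv] at this
        subst this
        have h0' : coeff 0 (f ∅) = 0 := h0
        simp [h0']
      · rfl
    · obtain ⟨v, hv⟩ := hne a ha
      refine ⟨monoChain a (wedge v (coeffChain a f)), ?_⟩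
      have hcyc : bdry (1 : V → k) (coeffChain a f) = 0 := by
        rw [← coeffChain_dK, hf]
        ext τ; simp [coeffChain]
      have := bdry_wedge (R := k) v (coeffChain a f)
      rw [hcyc] at this
      have hw : wedge v (0 : Finset V → k) = 0 := by ext τ; simp [wedge]
      rw [hw, add_zero] at this
      rw [dK_monoChain, this]
      intro τ hτ
      unfold wedge
      split_ifs with hvτ
      · rw [coeffChain, if_neg, smul_zero]
        contrapose! hτ
        intro u
        rcases eq_or_ne u v with rfl | huv
        · rw [expo_apply, if_pos hvτ]; omega
        · simpa [expo_apply, huv] using hτ u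
      · rfl
  choose g hg using hpart
  refine ⟨∑ a ∈ A, g a, ?_⟩
  rw [map_sum, Finset.sum_congr rfl fun a _ => hg a, ← hfA]

lemma free_acyclic {ι : Type} [Finite ι] (f : Finset V → (ι →₀ MvPolynomial V k))
    (hf : dK k f = 0) (h0 : ∀ b, constantCoeff (f ∅ b) = 0) : ∃ g, dK k g = f := by
  have h : ∀ b, ∃ g, dK k g = fun τ => f τ b := fun b => by
    refine poly_acyclic _ ?_ (h0 b)
    ext1 τ
    have := bdry_comp (X : V → MvPolynomial V k) (Finsupp.lapply b) f τ
    simp only [Finsupp.lapply_apply] at this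
    rw [dK, this, ← dK, hf]
    simp
  choose g hg using h
  refine ⟨fun τ => Finsupp.equivFunOnFinite.symm fun b => g b τ, ?_⟩
  ext1 τ
  ext1 b
  have := bdry_comp (X : V → MvPolynomial V k) (Finsupp.lapply b)
    (fun τ => Finsupp.equivFunOnFinite.symm fun b => g b τ) τ
  simp only [Finsupp.lapply_apply, Finsupp.equivFunOnFinite_symm_apply_apply] at this
  rw [dK, ← this]
  exact congrFun (hg b) τ

end Acyclicity
end Koszul

namespace Koszul

variable {k : Type} [Field k] {V : Type}

section TorVanish

variable {M N : Type} [AddCommGroup M] [Module (MvPolynomial V k) M]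
  [AddCommGroup N] [Module (MvPolynomial V k) N]

/-- Projection of Koszul chains to homological degree `i` and internal degree `D`. -/
def proj (G : Grading k V M) (i : ℕ) (D : ℤ) (f : Finset V → M) (τ : Finset V) : M :=
  if τ.card = i then G.comp (D - i) (f τ) else 0

lemma proj_proj (G : Grading k V M) (i : ℕ) (D : ℤ) (f : Finset V → M) :
    proj G i D (proj G i D f) = proj G i D f := by
  ext1 τ
  unfold proj
  split_ifs
  · rw [G.comp_comp]
  · rfl

lemma proj_add (G : Grading k V M) (i : ℕ) (D : ℤ) (f g : Finset V → M) :
    proj G i D (f + g) = proj G i D f + proj G i D g := by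
  ext1 τ
  simp only [proj, Pi.add_apply]
  split_ifs <;> simp

lemma proj_comp {GM : Grading k V M} {GN : Grading k V N} {δ : M →ₗ[MvPolynomial V k] N}
    (hδ : ∀ n m, GN.comp n (δ m) = δ (GM.comp n m)) (i : ℕ) (D : ℤ) (f : Finset V → M) :
    proj GN i D (fun τ => δ (f τ)) = fun τ => δ (proj GM i D f τ) := by
  ext1 τ
  unfold proj
  split_ifs
  · rw [hδ]
  · simp

variable [Fintype V] [LinearOrder V]

lemma proj_dK (G : Grading k V M) (i : ℕ) (D : ℤ) (f : Finset V → M) :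
    proj G i D (dK k f) = dK k (proj G (i + 1) D f) := by
  ext1 τ
  rw [proj, bdry_apply, bdry_apply]
  split_ifs with h
  · rw [map_sum]
    refine Finset.sum_congr rfl fun v _ => ?_
    simp only [contract_apply]
    by_cases hv : v ∈ τ
    · simp [hv]
    · have : D - i = (D - (i + 1 : ℕ)) + 1 := by push_cast; ring
      rw [if_neg hv, if_neg hv, this, G.comp_X, map_zsmul, proj,
        if_pos (by rw [Finset.card_insert_of_notMem hv, h])]
  · symm
    refine Finset.sum_eq_zero fun v _ => ?_
    rw [contract_apply]
    by_cases hv : v ∈ τ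
    · simp [hv]
    · rw [if_neg hv, proj, if_neg (by rw [Finset.card_insert_of_notMem hv]; omega)]
      simp

/-- Vanishing of `Tor_i(M / Z, k)_D`, in terms of the Koszul complex. -/
def TorVanish (G : Grading k V M) (Z : Submodule (MvPolynomial V k) M) (i : ℕ) (D : ℤ) : Prop :=
  ∀ f : Finset V → M, proj G i D f = f → (∀ τ, dK k f τ ∈ Z) →
    ∃ g : Finset V → M, ∀ τ, f τ - dK k g τ ∈ Z

/-- Exactness of the Koszul complex of `M`, up to the submodule `P` in homological degree `0`. -/
def Acyclic (P : Submodule (MvPolynomial V k) M) : Prop :=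
  ∀ f : Finset V → M, dK k f = 0 → f ∅ ∈ P → ∃ g, dK k g = f

lemma torVanish_range_iff {GM : Grading k V M} {GN : Grading k V N}
    {δ : M →ₗ[MvPolynomial V k] N} (hδ : ∀ n m, GN.comp n (δ m) = δ (GM.comp n m))
    {P : Submodule (MvPolynomial V k) N} (hP : Acyclic P) (hle : LinearMap.range δ ≤ P)
    (i : ℕ) (D : ℤ) :
    TorVanish GN (LinearMap.range δ) (i + 1) D ↔ TorVanish GM (LinearMap.ker δ) i D := by
  have hcomm : ∀ f : Finset V → M, dK k (fun σ => δ (f σ)) = fun τ => δ (dK k f τ) :=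
    fun f => funext (bdry_comp _ δ f)
  constructor
  · intro h f hf hdf
    have hdf' : dK k (fun τ => δ (f τ)) = 0 := by
      rw [hcomm]; exact funext hdf
    obtain ⟨g₀, hg₀⟩ := hP _ hdf' (hle ⟨_, rfl⟩)
    have hg : dK k (proj GN (i + 1) D g₀) = fun τ => δ (f τ) := by
      rw [← proj_dK, hg₀, proj_comp hδ, hf]
    obtain ⟨p, hp⟩ := h _ (proj_proj _ _ _ g₀) (fun τ => by rw [hg]; exact ⟨_, rfl⟩)
    choose c hc using hp
    refine ⟨c, fun τ => ?_⟩
    have hc' : (fun σ => δ (c σ)) = proj GN (i + 1) D g₀ - dK k p := funext hc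
    have h1 := congrFun (hcomm c) τ
    rw [hc', map_sub, hg, bdry_bdry, sub_zero] at h1
    rw [LinearMap.mem_ker, map_sub, ← h1, sub_self]
  · intro h f hf hdf
    choose g₀ hg₀ using hdf
    have hg : (fun τ => δ (proj GM i D g₀ τ)) = dK k f := by
      rw [← proj_comp hδ, funext hg₀, proj_dK, hf]
    obtain ⟨c, hc⟩ := h _ (proj_proj _ _ _ g₀) (fun τ => by
      rw [LinearMap.mem_ker, ← bdry_comp, hg, bdry_bdry]; rfl)
    have hcyc : dK k (f - fun τ => δ (c τ)) = 0 := by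
      rw [map_sub, hcomm, ← hg]
      ext1 τ
      have := hc τ
      rw [LinearMap.mem_ker, map_sub] at this
      exact this
    obtain ⟨p, hp⟩ := hP _ hcyc (by
      have : f ∅ = 0 := by rw [← hf, proj, if_neg (by simp)]
      rw [Pi.sub_apply, this, zero_sub]
      exact P.neg_mem (hle ⟨_, rfl⟩))
    refine ⟨p, fun τ => ?_⟩
    rw [hp]
    exact ⟨c τ, by simp⟩

end TorVanish

section Taylor

/-- The ideal generated by the monomials with exponents in `L`. -/
def monoIdeal (k : Type) [Field k] {V : Type} (L : List (V →₀ ℕ)) : Ideal (MvPolynomial V k) :=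
  Ideal.span ((fun s => monomial s (1 : k)) '' {s | s ∈ L})

lemma mem_monoIdeal {L : List (V →₀ ℕ)} {p : MvPolynomial V k} :
    p ∈ monoIdeal k L ↔ ∀ a ∈ p.support, ∃ s ∈ L, s ≤ a :=
  mem_ideal_span_monomial_image

lemma polyComp_mem_monoIdeal {L : List (V →₀ ℕ)} {p : MvPolynomial V k}
    (hp : p ∈ monoIdeal k L) (n : ℤ) : polyComp n p ∈ monoIdeal k L := by
  rw [mem_monoIdeal] at hp ⊢
  intro a ha
  refine hp a ?_
  rw [mem_support_iff, coeff_polyComp] at ha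
  rw [mem_support_iff]
  exact fun h => ha (by simp [h])

lemma monomial_mul_mem_monoIdeal {L : List (V →₀ ℕ)} {g : V →₀ ℕ} {p : MvPolynomial V k} :
    monomial g 1 * p ∈ monoIdeal k L ↔ p ∈ monoIdeal k (L.map (· - g)) := by
  simp only [mem_monoIdeal, mem_support_iff, List.mem_map, exists_exists_and_eq_and]
  constructor
  · intro h a ha
    obtain ⟨s, hs, hsa⟩ := h (g + a) (by rwa [coeff_monomial_mul, one_mul])
    exact ⟨s, hs, tsub_le_iff_left.mpr hsa⟩
  · intro h a ha
    rw [coeff_monomial_mul'] at ha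
    split_ifs at ha with hga
    · obtain ⟨s, hs, hsa⟩ := h (a - g) (by simpa using ha)
      refine ⟨s, hs, ?_⟩
      have := tsub_le_iff_left.mp hsa
      rwa [add_tsub_cancel_of_le hga] at this
    · exact absurd rfl ha

lemma mem_monoIdeal_cons {L : List (V →₀ ℕ)} {g : V →₀ ℕ} {p : MvPolynomial V k} :
    p ∈ monoIdeal k (g :: L) ↔ ∃ u, ∃ j ∈ monoIdeal k L, p = u * monomial g 1 + j := by
  have : {s | s ∈ g :: L} = insert g {s | s ∈ L} := by ext; simp
  rw [monoIdeal, this, Set.image_insert_eq, Ideal.mem_span_insert]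
  rfl

lemma polyComp_monomial_mul (g : V →₀ ℕ) (n : ℤ) (p : MvPolynomial V k) :
    polyComp n (monomial g 1 * p) = monomial g 1 * polyComp (n - g.degree) p := by
  rw [← polyComp_mul (isHomogeneous_monomial (1 : k) rfl), sub_add_cancel]

lemma proj_monomial_mul (g : V →₀ ℕ) (i : ℕ) (D : ℤ) (f : Finset V → MvPolynomial V k)
    (τ : Finset V) :
    proj (polyGrading k V) i D (fun τ => monomial g 1 * f τ) τ =
      monomial g 1 * proj (polyGrading k V) i (D - g.degree) f τ := by
  unfold proj
  split_ifs
  · rw [polyGrading_comp, polyGrading_comp, polyComp_monomial_mul, sub_right_comm]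
  · simp

lemma foldr_sup_map_tsub (g : V →₀ ℕ) (σ : List (V →₀ ℕ)) :
    (σ.map (· - g)).foldr (· ⊔ ·) 0 + g = g ⊔ σ.foldr (· ⊔ ·) 0 := by
  induction σ with
  | nil => ext; simp
  | cons s σ ih =>
    ext v
    have := DFunLike.congr_fun ih v
    simp only [List.map_cons, List.foldr_cons, Finsupp.add_apply, Finsupp.sup_apply,
      Finsupp.tsub_apply] at this ⊢
    omega

variable [Fintype V] [LinearOrder V]

lemma torVanish_bot {i : ℕ} {D : ℤ} (h : i ≠ 0 ∨ D ≠ 0) :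
    TorVanish (polyGrading k V) (monoIdeal k []) i D := by
  intro f hf hdf
  have hbot : monoIdeal k ([] : List (V →₀ ℕ)) = ⊥ := by simp [monoIdeal]
  rw [hbot] at hdf
  obtain ⟨g, hg⟩ := poly_acyclic f (funext hdf) (by
    rw [← hf, proj]
    split_ifs with h0
    · rw [Finset.card_empty] at h0
      subst h0
      rw [polyGrading_comp, constantCoeff_eq, coeff_polyComp, if_neg]
      have hD := h.resolve_left fun h => h rfl
      simpa using hD.symm
    · simp)
  exact ⟨g, fun τ => by rw [hg, sub_self]; exact Submodule.zero_mem _⟩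

lemma dK_of_proj_zero {M : Type} [AddCommGroup M] [Module (MvPolynomial V k) M]
    {G : Grading k V M} {D : ℤ} {f : Finset V → M} (hf : proj G 0 D f = f) : dK k f = 0 := by
  ext1 τ
  rw [bdry_apply]
  refine Finset.sum_eq_zero fun v _ => ?_
  rw [contract_apply, ← hf, proj,
    if_neg (Finset.card_ne_zero_of_mem (Finset.mem_insert_self v τ))]
  simp

lemma torVanish_cons_zero {L : List (V →₀ ℕ)} {g : V →₀ ℕ} {D : ℤ}
    (h : TorVanish (polyGrading k V) (monoIdeal k L) 0 D) :
    TorVanish (polyGrading k V) (monoIdeal k (g :: L)) 0 D := by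
  intro f hf _
  obtain ⟨p, hp⟩ := h f hf fun τ => by
    rw [dK_of_proj_zero hf]; exact Submodule.zero_mem _
  exact ⟨p, fun τ => mem_monoIdeal_cons.mpr ⟨0, _, hp τ, by simp⟩⟩

lemma torVanish_cons_succ {L : List (V →₀ ℕ)} {g : V →₀ ℕ} {i : ℕ} {D : ℤ}
    (h : TorVanish (polyGrading k V) (monoIdeal k L) (i + 1) D)
    (h' : TorVanish (polyGrading k V) (monoIdeal k (L.map (· - g))) i (D - g.degree)) :
    TorVanish (polyGrading k V) (monoIdeal k (g :: L)) (i + 1) D := by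
  set G := polyGrading k V
  have hclosed : ∀ (i : ℕ) (D : ℤ) (f : Finset V → MvPolynomial V k),
      (∀ τ, f τ ∈ monoIdeal k L) → ∀ τ, proj G i D f τ ∈ monoIdeal k L := by
    intro i D f hf τ
    unfold proj
    split_ifs
    · exact polyComp_mem_monoIdeal (hf τ) _
    · exact Submodule.zero_mem _
  have hcomm : ∀ (f : Finset V → MvPolynomial V k) τ,
      dK k (fun σ => monomial g 1 * f σ) τ = monomial g 1 * dK k f τ :=
    bdry_comp _ (LinearMap.mulLeft (MvPolynomial V k) (monomial g (1 : k)))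
  intro f hf hdf
  choose u₀ j₀ hj₀ hu₀ using fun τ => mem_monoIdeal_cons.mp (hdf τ)
  set u := proj G i (D - g.degree) u₀ with hu
  have hdf' : ∀ τ, dK k f τ - monomial g 1 * u τ ∈ monoIdeal k L := by
    intro τ
    have h1 : dK k f = proj G i D ((fun τ => monomial g 1 * u₀ τ) + j₀) := by
      conv_lhs => rw [← hf]
      rw [← proj_dK]
      congr 1
      ext1 τ
      rw [hu₀, Pi.add_apply, mul_comm]
    rw [h1, proj_add, Pi.add_apply, proj_monomial_mul, add_sub_cancel_left]
    exact hclosed _ _ _ hj₀ τ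
  have hdu : ∀ τ, dK k u τ ∈ monoIdeal k (L.map (· - g)) := by
    intro τ
    rw [← monomial_mul_mem_monoIdeal, ← hcomm]
    have h1 := bdry_mem (x := X) (f := dK k f - fun σ => monomial g 1 * u σ) hdf' τ
    rw [map_sub, bdry_bdry, zero_sub, Pi.neg_apply] at h1
    exact neg_mem_iff.mp h1
  obtain ⟨p, hp⟩ := h' u (proj_proj _ _ _ _) hdu
  set q := proj G (i + 1) (D - g.degree) p with hq
  have hgq : (fun τ => monomial g 1 * q τ) = proj G (i + 1) D (fun τ => monomial g 1 * p τ) := by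
    ext1 τ
    rw [proj_monomial_mul]
  obtain ⟨r, hr⟩ := h (proj G (i + 1) D (f - fun τ => monomial g 1 * p τ)) (proj_proj _ _ _ _) (by
    rw [← proj_dK]
    refine hclosed _ _ _ fun τ => ?_
    rw [map_sub, Pi.sub_apply, hcomm]
    have h1 := monomial_mul_mem_monoIdeal.mpr (hp τ)
    have h2 := Submodule.add_mem _ (hdf' τ) h1
    rwa [mul_sub, sub_add_sub_cancel] at h2)
  refine ⟨r, fun τ => mem_monoIdeal_cons.mpr ⟨q τ, _, hr τ, ?_⟩⟩
  have hsplit : f = proj G (i + 1) D (f - fun τ => monomial g 1 * p τ) +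
      fun τ => monomial g 1 * q τ := by
    rw [hgq, ← proj_add, sub_add_cancel, hf]
  have := congrFun hsplit τ
  rw [Pi.add_apply] at this
  rw [mul_comm, ← add_sub_assoc, add_comm, ← this]

/-- Nonvanishing Tor modules of a monomial quotient sit in the degrees of the Taylor complex. -/
lemma exists_sublist_of_not_torVanish (L : List (V →₀ ℕ)) (i : ℕ) (D : ℤ)
    (h : ¬ TorVanish (polyGrading k V) (monoIdeal k L) i D) :
    ∃ σ : List (V →₀ ℕ), σ.Sublist L ∧ σ.length = i ∧
      ((σ.foldr (· ⊔ ·) 0).degree : ℤ) = D := by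
  obtain ⟨n, hn⟩ : ∃ n, L.length = n := ⟨_, rfl⟩
  induction n generalizing L i D with
  | zero =>
    obtain rfl := List.eq_nil_of_length_eq_zero hn
    have h0 : i = 0 ∧ D = 0 := by
      by_contra hc
      exact h (torVanish_bot (by tauto))
    exact ⟨[], List.Sublist.refl _, by simp [h0.1], by simp [h0.2]⟩
  | succ n ih =>
    obtain _ | ⟨g, L⟩ := L
    · simp at hn
    have hL : L.length = n := by simpa using hn
    by_cases h1 : TorVanish (polyGrading k V) (monoIdeal k L) i D
    · obtain _ | i := i
      · exact absurd (torVanish_cons_zero h1) h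
      obtain ⟨σ', hσ', hlen, hdeg⟩ := ih (L.map (· - g)) i (D - g.degree)
        (fun h2 => h (torVanish_cons_succ h1 h2)) (by simpa using hL)
      obtain ⟨σ, hσ, rfl⟩ := List.sublist_map_iff.mp hσ'
      refine ⟨g :: σ, hσ.cons_cons g, by simpa using hlen, ?_⟩
      rw [List.foldr_cons, ← foldr_sup_map_tsub, map_add]
      push_cast
      rw [hdeg, sub_add_cancel]
    · obtain ⟨σ, hσ, hlen, hdeg⟩ := ih L i D h1 hL
      exact ⟨σ, hσ.cons g, hlen, hdeg⟩

end Taylor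

end Koszul

namespace Koszul

variable {k : Type} [Field k] {V : Type}

section Resolution

lemma constantCoeff_eq_zero_of_mem_mIdeal {p : MvPolynomial V k} (hp : p ∈ WOG.mIdeal k V) :
    constantCoeff p = 0 := by
  have h : WOG.mIdeal k V ≤ RingHom.ker (constantCoeff (σ := V) (R := k)) := by
    rw [WOG.mIdeal, Ideal.span_le]
    rintro _ ⟨v, rfl⟩
    simp
  exact h hp

lemma comp_map_of_single {ι : Type} {N : Type} [AddCommGroup N] [Module (MvPolynomial V k) N]
    (deg : ι → ℕ) (GN : Grading k V N)
    (δ : (ι →₀ MvPolynomial V k) →ₗ[MvPolynomial V k] N)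
    (h : ∀ a n (p : MvPolynomial V k), GN.comp n (p • δ (Finsupp.single a 1)) =
      polyComp (n - deg a) p • δ (Finsupp.single a 1))
    (n : ℤ) (f : ι →₀ MvPolynomial V k) :
    GN.comp n (δ f) = δ ((freeGrading k V deg).comp n f) := by
  have hs : ∀ a (p : MvPolynomial V k),
      δ (Finsupp.single a p) = p • δ (Finsupp.single a 1) := fun a p => by
    rw [← map_smul, Finsupp.smul_single, smul_eq_mul, mul_one]
  induction f using Finsupp.induction_linear with
  | zero => simp
  | add f g hf hg => simp only [map_add, hf, hg]
  | single a p => rw [freeGrading_comp_single, hs a p, h, ← hs]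

/-- The elements of a free module without constant terms. -/
def freeMax (k V ι : Type) [Field k] : Submodule (MvPolynomial V k) (ι →₀ MvPolynomial V k) where
  carrier := {f | ∀ b, constantCoeff (f b) = 0}
  add_mem' hf hg b := by simp [hf b, hg b]
  zero_mem' b := by simp
  smul_mem' r f hf b := by simp [hf b]

variable {I : Ideal (MvPolynomial V k)} (R : WOG.MinFreeRes I)

lemma range_d_le (n : ℕ) : LinearMap.range (R.d n) ≤ freeMax k V (R.ι n) := by
  rintro _ ⟨f, rfl⟩
  induction f using Finsupp.induction_linear with
  | zero => simp
  | add f g hf hg => rw [map_add]; exact Submodule.add_mem _ hf hg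
  | single a p =>
    have : R.d n (Finsupp.single a p) = p • R.d n (Finsupp.single a 1) := by
      rw [← map_smul, Finsupp.smul_single, smul_eq_mul, mul_one]
    rw [this]
    exact Submodule.smul_mem _ _ fun b =>
      constantCoeff_eq_zero_of_mem_mIdeal (R.minimal n a b)

lemma comp_d (i : ℕ) (n : ℤ) (f : R.ι (i + 1) →₀ MvPolynomial V k) :
    (freeGrading k V (R.deg i)).comp n (R.d i f) =
      R.d i ((freeGrading k V (R.deg (i + 1))).comp n f) := by
  refine comp_map_of_single _ _ _ (fun a n p => ?_) n f
  ext1 b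
  rw [freeGrading_comp_apply, Finsupp.smul_apply, Finsupp.smul_apply, smul_eq_mul, smul_eq_mul]
  rcases R.d_homog i a b with h | ⟨e, he, h⟩
  · rw [h, mul_zero, mul_zero, polyComp_zero]
  · have : n - R.deg i b = (n - R.deg (i + 1) a) + e := by rw [he]; push_cast; ring
    rw [this, mul_comm, polyComp_mul h, mul_comm]

lemma comp_aug (n : ℤ) (f : R.ι 0 →₀ MvPolynomial V k) :
    (polyGrading k V).comp n (R.aug f) = R.aug ((freeGrading k V (R.deg 0)).comp n f) := by
  refine comp_map_of_single _ _ _ (fun a n p => ?_) n f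
  rw [polyGrading_comp, smul_eq_mul, smul_eq_mul, mul_comm, mul_comm _ (R.aug _),
    ← polyComp_mul (R.aug_homog a), sub_add_cancel]

variable [Fintype V] [LinearOrder V]

lemma acyclic_freeMax (ι : Type) [Finite ι] : Acyclic (freeMax k V ι) :=
  fun f hf h0 => free_acyclic f hf h0

lemma acyclic_poly : Acyclic (RingHom.ker (constantCoeff (σ := V) (R := k))) :=
  fun f hf h0 => poly_acyclic f hf h0

lemma torVanish_range_d_zero_iff (n : ℕ) (D : ℕ) :
    TorVanish (freeGrading k V (R.deg n)) (LinearMap.range (R.d n)) 0 D ↔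
      ∀ a, R.deg n a ≠ D := by
  have := R.finite n
  constructor
  · intro h a ha
    set f : Finset V → (R.ι n →₀ MvPolynomial V k) :=
      fun τ => if τ.card = 0 then Finsupp.single a 1 else 0 with hf
    have hpf : proj (freeGrading k V (R.deg n)) 0 D f = f := by
      ext1 τ
      simp only [proj, hf]
      split_ifs with hτ
      · rw [freeGrading_comp_single, ha]
        congr 1
        simpa using polyComp_of_isHomogeneous (isHomogeneous_one V k)
      · rfl
    obtain ⟨g, hg⟩ := h f hpf fun τ => by
      rw [dK_of_proj_zero hpf]; exact Submodule.zero_mem _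
    have h1 := range_d_le R n (hg ∅) a
    have h2 : constantCoeff (dK k g ∅ a) = 0 := by
      rw [bdry_apply, Finsupp.finsetSum_apply, map_sum]
      exact Finset.sum_eq_zero fun v _ => by simp
    rw [Finsupp.sub_apply, map_sub, h2] at h1
    simp [hf] at h1
  · intro h f hf _
    obtain ⟨g, hg⟩ := acyclic_freeMax (R.ι n) f (dK_of_proj_zero hf) (by
      intro b
      rw [← hf, proj, if_pos Finset.card_empty, freeGrading_comp_apply, constantCoeff_eq,
        coeff_polyComp, if_neg]
      have := h b
      simp only [map_zero]
      omega)
    exact ⟨g, fun τ => by rw [hg, sub_self]; exact Submodule.zero_mem _⟩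

/-- The degrees of a minimal free resolution are the degrees of nonvanishing Koszul homology. -/
lemma torVanish_iff (hI : I ≤ RingHom.ker (constantCoeff (σ := V) (R := k))) (i D : ℕ) :
    TorVanish (polyGrading k V) I (i + 1) D ↔ ∀ a, R.deg i a ≠ D := by
  have hstep : ∀ i n : ℕ,
      TorVanish (freeGrading k V (R.deg n)) (LinearMap.range (R.d n)) i D ↔
        TorVanish (freeGrading k V (R.deg (n + i))) (LinearMap.range (R.d (n + i))) 0 D := by
    intro i
    induction i with
    | zero => intro n; rfl
    | succ i ih =>
      intro n
      have := R.finite n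
      rw [torVanish_range_iff (comp_d R n) (acyclic_freeMax _) (range_d_le R n),
        ← R.exact_succ, ih, Nat.succ_add_eq_add_succ]
  have h0 := torVanish_range_iff (comp_aug R) acyclic_poly (R.aug_range.trans_le hI) i D
  rw [R.aug_range, ← R.exact_zero, hstep] at h0
  rw [h0, torVanish_range_d_zero_iff, Nat.zero_add]

lemma not_torVanish_socle {s : MvPolynomial V k} {D : ℤ} (hs : polyComp D s = s) (hsI : s ∉ I)
    (hX : ∀ v, X v * s ∈ I) :
    ¬ TorVanish (polyGrading k V) I (Fintype.card V) (D + Fintype.card V) := by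
  intro h
  set f : Finset V → MvPolynomial V k := fun τ => if τ.card = Fintype.card V then s else 0 with hf
  obtain ⟨g, hg⟩ := h f (by
      ext1 τ
      simp only [proj, hf]
      split_ifs
      · rw [add_sub_cancel_right, polyGrading_comp, hs]
      · rfl) (fun τ => by
    rw [bdry_apply]
    refine I.sum_mem fun v _ => ?_
    rw [contract_apply]
    split_ifs
    · simp
    · simp only [hf]
      split_ifs
      · rw [smul_comm]
        exact zsmul_mem (hX v) _
      · simp)
  have h1 := hg Finset.univ
  have h2 : dK k g Finset.univ = 0 := by
    rw [bdry_apply]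
    exact Finset.sum_eq_zero fun v _ => by simp [contract_apply]
  rw [h2, sub_zero] at h1
  exact hsI (by simpa [hf] using h1)

end Resolution

end Koszul

namespace Koszul

variable {k : Type} [Field k] {V : Type}

/-- The exponent vector of the generator `x * y ^ w y` attached to an edge `(x, y)`. -/
def edgeExp (w : V → ℕ) (e : V × V) : V →₀ ℕ :=
  Finsupp.single e.1 1 + Finsupp.single e.2 (w e.2)

lemma edgeIdeal_eq_monoIdeal {E : Set (V × V)} {es : List (V × V)} (hes : ∀ e, e ∈ es ↔ e ∈ E)
    (w : V → ℕ) : WOG.edgeIdeal k E w = monoIdeal k (es.map (edgeExp w)) := by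
  rw [WOG.edgeIdeal, monoIdeal]
  congr 1
  ext p
  simp only [Set.mem_ofPred_eq, Set.mem_image, List.mem_map, exists_exists_and_eq_and, hes]
  refine exists_congr fun e => and_congr_right fun _ => ?_
  rw [edgeExp, X_pow_eq_monomial, X, monomial_mul, one_mul, eq_comm]

lemma foldr_sup_apply_le {σ : List (V →₀ ℕ)} {b : V → ℕ} (h : ∀ s ∈ σ, ∀ v, s v ≤ b v) (v : V) :
    σ.foldr (· ⊔ ·) 0 v ≤ b v := by
  induction σ with
  | nil => simp
  | cons s σ ih =>
    rw [List.foldr_cons, Finsupp.sup_apply]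
    exact sup_le (h s List.mem_cons_self v) (ih fun t ht => h t (List.mem_cons_of_mem _ ht))

lemma degree_lcm_edges_le [Fintype V] {w : V → ℕ} (hw : ∀ v, 2 ≤ w v) {es : List (V × V)}
    (hne : ∀ e ∈ es, e.1 ≠ e.2) :
    (((es.map (edgeExp w)).foldr (· ⊔ ·) 0).degree : ℤ) ≤
      (∑ v, (w v : ℤ)) - Fintype.card V + es.length := by
  classical
  set T : Finset V := (es.map Prod.snd).toFinset with hT
  have hTcard : T.card ≤ es.length := by
    simpa using List.toFinset_card_le (es.map Prod.snd)
  have hle := foldr_sup_apply_le (σ := es.map (edgeExp w))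
    (b := fun v => if v ∈ T then w v else 1) (by
      intro s hs v
      obtain ⟨e, he, rfl⟩ := List.mem_map.mp hs
      have h2 : e.2 ∈ T := by
        rw [hT, List.mem_toFinset]; exact List.mem_map_of_mem he
      have := hw v
      rw [edgeExp, Finsupp.add_apply, Finsupp.single_apply, Finsupp.single_apply]
      rcases eq_or_ne e.2 v with rfl | hv
      · simp [hne e he, h2]
      · simp only [hv, if_false, add_zero]
        split_ifs <;> omega)
  rw [Finsupp.degree_eq_sum]
  push_cast
  calc _ ≤ ∑ v, (((w v : ℤ) - 1) + if v ∈ T then 1 else 0) := by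
        refine Finset.sum_le_sum fun v _ => ?_
        have h1 := hle v
        have h2 := hw v
        split_ifs at h1 ⊢ <;> omega
    _ = (∑ v, (w v : ℤ)) - Fintype.card V + T.card := by
        simp [Finset.sum_add_distrib, Finset.sum_sub_distrib]
    _ ≤ _ := by
        have : (T.card : ℤ) ≤ es.length := by exact_mod_cast hTcard
        linarith

/-- In an edge ideal without sources or loops, and with weights at least two, the monomial with
exponents `w - 1` is a socle element of the quotient. -/
lemma socle_edgeIdeal [Fintype V] {w : V → ℕ} (hw : ∀ v, 2 ≤ w v) {es : List (V × V)}
    (hne : ∀ e ∈ es, e.1 ≠ e.2) (hin : ∀ v, ∃ e ∈ es, e.2 = v) :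
    let a : V →₀ ℕ := Finsupp.equivFunOnFinite.symm fun v => w v - 1
    monomial a (1 : k) ∉ monoIdeal k (es.map (edgeExp w)) ∧
      ∀ v, X v * monomial a (1 : k) ∈ monoIdeal k (es.map (edgeExp w)) := by
  classical
  intro a
  have ha : ∀ v, a v = w v - 1 := fun v => rfl
  constructor
  · intro h
    obtain ⟨s, hs, hsa⟩ := mem_monoIdeal.mp h a (by simp [mem_support_iff])
    obtain ⟨e, he, rfl⟩ := List.mem_map.mp hs
    have h1 := hsa e.2
    have h2 := hw e.2
    rw [edgeExp, Finsupp.add_apply, Finsupp.single_eq_same, ha] at h1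
    omega
  · intro v
    rw [mem_monoIdeal]
    intro b hb
    obtain ⟨e, he, rfl⟩ := hin v
    refine ⟨_, List.mem_map_of_mem he, ?_⟩
    have hb' : b = Finsupp.single e.2 1 + a := by
      rw [X, monomial_mul, mem_support_iff, coeff_monomial] at hb
      by_contra hc
      exact hb (if_neg fun h => hc h.symm)
    rw [hb', edgeExp]
    intro u
    have h1 := hw u
    simp only [Finsupp.add_apply, Finsupp.single_apply, ha]
    rcases eq_or_ne e.2 u with rfl | hu
    · simp [hne e he]; omega
    · simp only [hu, if_false]
      split_ifs <;> omega

lemma edgeIdeal_le_ker {E : Set (V × V)} (w : V → ℕ) :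
    WOG.edgeIdeal k E w ≤ RingHom.ker (constantCoeff (σ := V) (R := k)) := by
  rw [WOG.edgeIdeal, Ideal.span_le]
  rintro _ ⟨e, _, rfl⟩
  simp

lemma betti_ne_zero_iff {I : Ideal (MvPolynomial V k)} (R : WOG.MinFreeRes I) (i j : ℕ) :
    R.betti i j ≠ 0 ↔ ∃ a, R.deg i a = j := by
  have := R.finite i
  rw [WOG.MinFreeRes.betti, Nat.card_ne_zero, nonempty_subtype]
  exact and_iff_left inferInstance

/-- The regularity of the edge ideal of a weighted oriented graph without sources or loops, all of
whose weights are at least two. -/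
theorem isGreatest_regSet_edgeIdeal [Fintype V] [Nonempty V] {E : Set (V × V)} {w : V → ℕ}
    (hw : ∀ v, 2 ≤ w v) (hne : ∀ e ∈ E, e.1 ≠ e.2) (hin : ∀ v, ∃ e ∈ E, e.2 = v)
    (R : WOG.MinFreeRes (WOG.edgeIdeal k E w)) :
    IsGreatest R.regSet ((∑ v, (w v : ℤ)) - Fintype.card V + 1) := by
  classical
  let _ : LinearOrder V := LinearOrder.lift' _ (Fintype.equivFin V).injective
  set es : List (V × V) := E.toFinite.toFinset.toList
  have hes : ∀ e, e ∈ es ↔ e ∈ E := by simp [es]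
  have hI := edgeIdeal_eq_monoIdeal (k := k) hes w
  have hker := edgeIdeal_le_ker (k := k) (E := E) w
  have hbetti : ∀ i j, R.betti i j ≠ 0 ↔
      ¬ TorVanish (polyGrading k V) (monoIdeal k (es.map (edgeExp w))) (i + 1) j := by
    intro i j
    rw [betti_ne_zero_iff, ← hI, torVanish_iff R hker]
    push Not
    rfl
  constructor
  · obtain ⟨hs, hX⟩ := socle_edgeIdeal (k := k) hw (fun e he => hne e ((hes e).mp he))
      (fun v => by simpa only [hes] using hin v)
    set a : V →₀ ℕ := Finsupp.equivFunOnFinite.symm fun v => w v - 1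
    have hsoc := not_torVanish_socle
      (polyComp_of_isHomogeneous (isHomogeneous_monomial (1 : k) (rfl : a.degree = a.degree))) hs hX
    have hcard : Fintype.card V - 1 + 1 = Fintype.card V :=
      Nat.sub_add_cancel Fintype.card_pos
    have hdeg : a.degree + Fintype.card V = ∑ v, w v := by
      rw [Finsupp.degree_eq_sum, Fintype.card_eq_sum_ones, ← Finset.sum_add_distrib]
      refine Finset.sum_congr rfl fun v _ => ?_
      have := hw v
      change w v - 1 + 1 = w v
      omega
    refine ⟨Fintype.card V - 1, a.degree + Fintype.card V, ?_, ?_⟩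
    · rw [hbetti, hcard]
      exact_mod_cast hsoc
    · rw [hdeg]
      push_cast [Nat.cast_sub (Fintype.card_pos (α := V))]
      ring
  · rintro _ ⟨i, j, hij, rfl⟩
    obtain ⟨σ', hσ', hlen, hdeg⟩ := exists_sublist_of_not_torVanish _ _ _ ((hbetti i j).mp hij)
    obtain ⟨σ, hσ, rfl⟩ := List.sublist_map_iff.mp hσ'
    have := degree_lcm_edges_le hw fun e he => hne e ((hes e).mp (hσ.subset he))
    rw [hdeg] at this
    rw [List.length_map] at hlen
    rw [hlen] at this
    push_cast at this
    linarith

end Koszul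

/-- **Theorem (third class, regularity).**
`D` is a vertex-weighted oriented `m`-partite graph (`m ≥ 3`) of the third
class: the vertex set is partitioned into nonempty parts `V_1, …, V_m`
(encoded by `part : V → Fin m`), and, with the convention `V_{m+1} = V_1`,
its edges are exactly all pairs going from a vertex of `V_i` to a vertex of
`V_{i+1}` (`1 ≤ i ≤ m`), i.e. each `D_i` is a complete bipartite graph
oriented from `V_i` to `V_{i+1}`.  All weights are `≥ 2`.
Then `reg I(D) = (∑_{x ∈ V} w(x)) - |V| + 1`. -/
theorem third_class_reg (k : Type) [Field k] (m : ℕ) (hm : 3 ≤ m)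
    (V : Type) [Fintype V] (part : V → Fin m) (hpart : ∀ i : Fin m, ∃ x : V, part x = i)
    (E : Set (V × V))
    (hE : E = {p : V × V | (part p.2 : ℕ) = ((part p.1 : ℕ) + 1) % m})
    (w : V → ℕ) (hw2 : ∀ x : V, 2 ≤ w x)
    (R : WOG.MinFreeRes (WOG.edgeIdeal k E w)) :
    IsGreatest R.regSet ((∑ x : V, (w x : ℤ)) - (Fintype.card V : ℤ) + 1) := by
  have : NeZero m := ⟨by omega⟩
  have : Nonempty V := ⟨(hpart 0).choose⟩
  refine Koszul.isGreatest_regSet_edgeIdeal hw2 ?_ ?_ R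
  · rintro ⟨x, y⟩ hxy heq
    rw [hE, Set.mem_ofPred_eq] at hxy
    simp only at hxy heq
    subst heq
    have hlt := (part x).isLt
    rcases eq_or_ne ((part x : ℕ) + 1) m with h | h
    · rw [h, Nat.mod_self] at hxy; omega
    · rw [Nat.mod_eq_of_lt (by omega)] at hxy; omega
  · intro v
    have hlt := (part v).isLt
    obtain ⟨i, hi⟩ : ∃ i : Fin m, (part v : ℕ) = ((i : ℕ) + 1) % m := by
      rcases Nat.eq_zero_or_pos (part v : ℕ) with h | h
      · exact ⟨⟨m - 1, by omega⟩, by rw [h, Nat.sub_add_cancel (by omega), Nat.mod_self]⟩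
      · exact ⟨⟨(part v : ℕ) - 1, by omega⟩, by
          rw [Nat.sub_add_cancel h, Nat.mod_eq_of_lt hlt]⟩
    obtain ⟨x, rfl⟩ := hpart i
    exact ⟨(x, v), by rw [hE]; exact hi, rfl⟩
end
end

section
/- Let m ≥ 3 be an integer and let D = (V,E,w) be a vertex-weighted oriented m-partite graph of the third class (with m parts). Assume w(x) ≥ 2 for all x ∈ V. Then the projective dimension of the edge ideal satisfies pd(I(D)) = |V| − 1. -/
open MvPolynomial

noncomputable section

namespace WOG

section KoszulHomology

variable {R V : Type*} [CommRing R] {x : V → R} {M : ℕ → Type*}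
  [∀ i, AddCommGroup (M i)] [∀ i, Module R (M i)] {d : ∀ i, M (i + 1) →ₗ[R] M i}

open Ideal

theorem mem_span_image_insert_smul_top {N : Type*} [AddCommGroup N] [Module R N]
    {A : Set V} {v : V} {y : N} :
    y ∈ span (x '' insert v A) • (⊤ : Submodule R N) ↔
      ∃ a ∈ span (x '' A) • (⊤ : Submodule R N), ∃ b : N, y = a + x v • b := by
  rw [Set.image_insert_eq, span_insert, Submodule.sup_smul, sup_comm, Submodule.mem_sup]
  simp only [Submodule.ideal_span_singleton_smul,
    Submodule.mem_smul_pointwise_iff_exists, Submodule.mem_top, true_and]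
  constructor
  · rintro ⟨a, ha, _, ⟨b, rfl⟩, rfl⟩
    exact ⟨a, ha, b, rfl⟩
  · rintro ⟨a, ha, b, rfl⟩
    exact ⟨a, ha, _, ⟨b, rfl⟩, rfl⟩

theorem map_mem_smul_top {N P : Type*} [AddCommGroup N] [Module R N] [AddCommGroup P]
    [Module R P] (f : N →ₗ[R] P) {J : Ideal R} {y : N} (hy : y ∈ J • (⊤ : Submodule R N)) :
    f y ∈ J • (⊤ : Submodule R P) := by
  have h := Submodule.mem_map_of_mem (f := f) hy
  rw [Submodule.map_smul''] at h
  exact Submodule.smul_mono le_rfl le_top h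

/-- Vanishing of `Tor_i(R / (x_v : v ∈ A), -)` for `i > |A|`, in terms of a resolution `M`
on whose terms the elements `x_v` form a regular sequence in any order. -/
theorem mem_range_sup_of_card_le [DecidableEq V]
    (hexact : ∀ i, LinearMap.range (d (i + 1)) = LinearMap.ker (d i))
    (hreg : ∀ i (A : Finset V), ∀ v ∉ A, ∀ y : M i,
      x v • y ∈ span (x '' A) • (⊤ : Submodule R (M i)) →
        y ∈ span (x '' A) • (⊤ : Submodule R (M i)))
    (A : Finset V) : ∀ i, A.card ≤ i → ∀ z : M (i + 1),
      d i z ∈ span (x '' A) • (⊤ : Submodule R (M i)) →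
      z ∈ LinearMap.range (d (i + 1)) ⊔ span (x '' A) • (⊤ : Submodule R (M (i + 1))) := by
  induction A using Finset.induction_on with
  | empty =>
    intro i _ z hz
    rw [hexact]
    exact Submodule.mem_sup_left (by simpa using hz)
  | insert v A hv ih =>
    intro i hi z hz
    rw [Finset.card_insert_of_notMem hv] at hi
    obtain ⟨j, rfl⟩ : ∃ j, i = j + 1 := ⟨i - 1, by omega⟩
    rw [Finset.coe_insert] at hz ⊢
    obtain ⟨a, ha, b, hab⟩ := mem_span_image_insert_smul_top.1 hz
    have hdd : ∀ y, d j (d (j + 1) y) = 0 := fun y => by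
      have : d (j + 1) y ∈ LinearMap.ker (d j) := hexact j ▸ ⟨y, rfl⟩
      exact this
    have hb : b ∈ _ := ih j (by omega) b (hreg j A v hv _ (by
      have h := hdd z
      rw [hab, map_add, map_smul] at h
      rw [eq_neg_of_add_eq_zero_right h]
      exact neg_mem (map_mem_smul_top _ ha)))
    obtain ⟨_, ⟨c, rfl⟩, b', hb', rfl⟩ := Submodule.mem_sup.1 hb
    have hz' : z - x v • c ∈ _ := ih (j + 1) (by omega) (z - x v • c) (by
      have h : d (j + 1) (z - x v • c) = a + x v • b' := by
        rw [map_sub, hab, map_smul, smul_add]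
        abel
      rw [h]
      exact add_mem ha (Submodule.smul_mem _ _ hb'))
    obtain ⟨e, he, f, hf, hef⟩ := Submodule.mem_sup.1 hz'
    exact Submodule.mem_sup.2 ⟨e, he, f + x v • c,
      mem_span_image_insert_smul_top.2 ⟨f, hf, c, rfl⟩, by rw [← add_assoc, hef]; abel⟩

/-- A nonzero class in `M 0 / d (M 1)` killed by all `x_v` yields, for each `A`, a nonzero class
in degree `|A|` of `M / (x_v : v ∈ A) M` killed by all `x_v`. -/
theorem exists_notMem_range_sup [DecidableEq V]
    (hexact : ∀ i, LinearMap.range (d (i + 1)) = LinearMap.ker (d i))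
    (hreg : ∀ i (A : Finset V), ∀ v ∉ A, ∀ y : M i,
      x v • y ∈ span (x '' A) • (⊤ : Submodule R (M i)) →
        y ∈ span (x '' A) • (⊤ : Submodule R (M i)))
    (u : M 0) (hu : u ∉ LinearMap.range (d 0))
    (hsoc : ∀ v, x v • u ∈ LinearMap.range (d 0)) (A : Finset V) :
    ∀ r, A.card = r → ∃ z : M r,
      z ∉ LinearMap.range (d r) ⊔ span (x '' A) • (⊤ : Submodule R (M r)) ∧
      ∀ v, x v • z ∈ LinearMap.range (d r) ⊔ span (x '' A) • (⊤ : Submodule R (M r)) := by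
  induction A using Finset.induction_on with
  | empty =>
    rintro r rfl
    refine ⟨u, ?_⟩
    rw [Finset.coe_empty, Set.image_empty, span_empty, Submodule.bot_smul, sup_bot_eq]
    exact ⟨hu, hsoc⟩
  | insert v A hv ih =>
    intro r hr
    rw [Finset.card_insert_of_notMem hv] at hr
    subst hr
    obtain ⟨z, hz, hzs⟩ := ih _ rfl
    obtain ⟨_, ⟨y, rfl⟩, g, hg, hyg⟩ := Submodule.mem_sup.1 (hzs v)
    rw [Finset.coe_insert]
    refine ⟨y, fun hy => hz ?_, fun t => ?_⟩
    · obtain ⟨e, he, f, hf, rfl⟩ := Submodule.mem_sup.1 hy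
      obtain ⟨a, ha, h, rfl⟩ := mem_span_image_insert_smul_top.1 hf
      rw [hexact] at he
      have he' : d A.card e = 0 := he
      have key : z - d A.card h ∈ span (x '' A) • (⊤ : Submodule R (M A.card)) := by
        refine hreg _ A v hv _ ?_
        have : x v • (z - d A.card h) = d A.card a + g := by
          rw [smul_sub, ← hyg, map_add, map_add, he', map_smul]
          abel
        rw [this]
        exact add_mem (map_mem_smul_top _ ha) hg
      exact Submodule.mem_sup.2 ⟨d A.card h, ⟨h, rfl⟩, _, key, by abel⟩
    · obtain ⟨_, ⟨y', rfl⟩, g', hg', hyg'⟩ := Submodule.mem_sup.1 (hzs t)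
      have key := mem_range_sup_of_card_le hexact hreg A _ le_rfl (x t • y - x v • y') (by
        have : d A.card (x t • y - x v • y') = x v • g' - x t • g := by
          rw [map_sub, map_smul, map_smul, eq_sub_of_add_eq hyg, eq_sub_of_add_eq hyg',
            smul_sub, smul_sub, smul_comm (x t)]
          abel
        rw [this]
        exact sub_mem (Submodule.smul_mem _ _ hg') (Submodule.smul_mem _ _ hg))
      obtain ⟨e, he, f, hf, hef⟩ := Submodule.mem_sup.1 key
      exact Submodule.mem_sup.2 ⟨e, he, f + x v • y',
        mem_span_image_insert_smul_top.2 ⟨f, hf, y', rfl⟩, by rw [← add_assoc, hef]; abel⟩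

end KoszulHomology

theorem mem_ideal_smul_top_finsupp_iff {R ι : Type*} [CommRing R] {J : Ideal R} {y : ι →₀ R} :
    y ∈ J • (⊤ : Submodule R (ι →₀ R)) ↔ ∀ b, y b ∈ J := by
  constructor
  · intro hy b
    simpa using map_mem_smul_top (Finsupp.lapply (R := R) b) hy
  · intro hy
    rw [← Finsupp.sum_single y]
    refine Submodule.sum_mem _ fun b _ => ?_
    have : Finsupp.single b (y b) = y b • Finsupp.single b (1 : R) := by simp
    rw [this]
    exact Submodule.smul_mem_smul (hy b) trivial

theorem mem_span_X_image_of_X_mul_mem {k V : Type*} [Field k] {A : Set V} {v : V} (hv : v ∉ A)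
    {p : MvPolynomial V k} (hp : X v * p ∈ Ideal.span (X '' A : Set (MvPolynomial V k))) :
    p ∈ Ideal.span (X '' A : Set (MvPolynomial V k)) := by
  classical
  rw [mem_ideal_span_X_image] at hp ⊢
  intro s hs
  obtain ⟨i, hi, h⟩ := hp (Finsupp.single v 1 + s) (by
    rw [mem_support_iff, coeff_X_mul]
    exact mem_support_iff.1 hs)
  have hne : v ≠ i := fun h => hv (h ▸ hi)
  exact ⟨i, hi, by simpa [hne] using h⟩

theorem one_notMem_mIdeal (k V : Type) [Field k] : (1 : MvPolynomial V k) ∉ mIdeal k V := by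
  classical
  rw [mIdeal, ← Set.image_univ, mem_ideal_span_X_image]
  intro h
  obtain ⟨i, -, hi⟩ := h 0 (by simp)
  exact hi rfl

namespace MinFreeRes

variable {k V : Type} [Field k] {I : Ideal (MvPolynomial V k)} (R : MinFreeRes I)

theorem mem_pdSet_iff {i : ℕ} : i ∈ R.pdSet ↔ Nonempty (R.ι i) := by
  have := R.finite i
  simp only [pdSet, betti, Set.mem_ofPred_eq, Nat.card_ne_zero]
  exact ⟨fun ⟨_, ⟨a⟩, _⟩ => ⟨a⟩, fun ⟨a⟩ => ⟨R.deg i a, ⟨a, rfl⟩, inferInstance⟩⟩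

theorem d_apply_mem (i : ℕ) (y : R.ι (i + 1) →₀ MvPolynomial V k) :
    R.d i y ∈ mIdeal k V • (⊤ : Submodule (MvPolynomial V k) (R.ι i →₀ MvPolynomial V k)) := by
  rw [← Finsupp.sum_single y, Finsupp.sum, map_sum]
  refine Submodule.sum_mem _ fun a _ => ?_
  have : Finsupp.single a (y a) = y a • Finsupp.single a (1 : MvPolynomial V k) := by simp
  rw [this, map_smul]
  exact Submodule.smul_mem _ _ (mem_ideal_smul_top_finsupp_iff.2 (R.minimal i a))

/-- The basis indices of the resolution `⋯ → F₁ → F₀ → S` of `S / I`. -/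
def quotι : ℕ → Type
  | 0 => Unit
  | i + 1 => R.ι i

/-- The differentials of the resolution `⋯ → F₁ → F₀ → S` of `S / I`. -/
def quotd : ∀ i, (R.quotι (i + 1) →₀ MvPolynomial V k) →ₗ[MvPolynomial V k]
    (R.quotι i →₀ MvPolynomial V k)
  | 0 => (Finsupp.lsingle () : MvPolynomial V k →ₗ[MvPolynomial V k] _) ∘ₗ R.aug
  | i + 1 => R.d i

theorem quotd_exact : ∀ i, LinearMap.range (R.quotd (i + 1)) = LinearMap.ker (R.quotd i)
  | 0 => by
    refine R.exact_zero.trans ?_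
    exact (LinearMap.ker_comp_of_ker_eq_bot _ (Finsupp.ker_lsingle ())).symm
  | i + 1 => R.exact_succ i

theorem exists_socle_quotd {u : MvPolynomial V k} (hu : u ∉ I) (hsoc : ∀ v, X v * u ∈ I) :
    ∃ z : R.quotι 0 →₀ MvPolynomial V k, z ∉ LinearMap.range (R.quotd 0) ∧
      ∀ v, (X v : MvPolynomial V k) • z ∈ LinearMap.range (R.quotd 0) := by
  refine ⟨(Finsupp.single () u : Unit →₀ MvPolynomial V k), ?_, fun v => ?_⟩
  · rintro ⟨y, hy⟩
    have hy' : R.aug y = u := Finsupp.single_injective () hy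
    exact hu (R.aug_range.le ⟨y, hy'⟩)
  · obtain ⟨y, hy⟩ := R.aug_range.ge (hsoc v)
    have h : Finsupp.single () (R.aug y) =
        (X v : MvPolynomial V k) • (Finsupp.single () u : Unit →₀ MvPolynomial V k) := by
      rw [hy, Finsupp.smul_single, smul_eq_mul]
    exact ⟨y, h⟩

theorem mem_span_smul_top_of_X_smul_mem (i : ℕ) (A : Finset V) (v : V) (hv : v ∉ A)
    (y : R.quotι i →₀ MvPolynomial V k)
    (hy : (X v : MvPolynomial V k) • y ∈
      Ideal.span (X '' (A : Set V) : Set (MvPolynomial V k)) •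
        (⊤ : Submodule (MvPolynomial V k) (R.quotι i →₀ MvPolynomial V k))) :
    y ∈ Ideal.span (X '' (A : Set V) : Set (MvPolynomial V k)) •
      (⊤ : Submodule (MvPolynomial V k) (R.quotι i →₀ MvPolynomial V k)) := by
  rw [mem_ideal_smul_top_finsupp_iff] at hy ⊢
  exact fun b => mem_span_X_image_of_X_mul_mem (by simpa using hv) (hy b)

variable [Fintype V]

theorem isEmpty_of_card_le {i : ℕ} (hV : 0 < Fintype.card V) (hi : Fintype.card V ≤ i) :
    IsEmpty (R.ι i) := by
  classical
  refine ⟨fun a => one_notMem_mIdeal k V ?_⟩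
  obtain ⟨j, rfl⟩ : ∃ j, i = j + 1 := ⟨i - 1, by omega⟩
  have hm : Ideal.span ((X : V → MvPolynomial V k) '' (Finset.univ : Finset V)) = mIdeal k V := by
    simp [mIdeal]
  have h := mem_range_sup_of_card_le R.quotd_exact R.mem_span_smul_top_of_X_smul_mem
    Finset.univ (j + 1) hi (Finsupp.single a 1 : R.ι (j + 1) →₀ MvPolynomial V k)
    (by rw [hm]; exact R.d_apply_mem j _)
  rw [hm, sup_eq_right.2 (by rintro _ ⟨y, rfl⟩; exact R.d_apply_mem (j + 1) y)] at h
  have ha := mem_ideal_smul_top_finsupp_iff.1 h a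
  exact (Finsupp.single_eq_same (a := a) (b := (1 : MvPolynomial V k))) ▸ ha

theorem nonempty_of_socle {u : MvPolynomial V k} (hu : u ∉ I) (hsoc : ∀ v, X v * u ∈ I)
    {i : ℕ} (hi : Fintype.card V = i + 1) : Nonempty (R.ι i) := by
  classical
  obtain ⟨z₀, hz₀, hs⟩ := R.exists_socle_quotd hu hsoc
  obtain ⟨z, hz, -⟩ := exists_notMem_range_sup R.quotd_exact R.mem_span_smul_top_of_X_smul_mem
    z₀ hz₀ hs Finset.univ (i + 1) hi
  by_contra hne
  rw [not_nonempty_iff] at hne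
  have : IsEmpty (R.quotι (i + 1)) := hne
  exact hz (Subsingleton.elim 0 z ▸ zero_mem _)

/-- If `S / I` has a nonzero socle, then `pd I = |V| - 1`. -/
theorem isGreatest_pdSet_of_socle (hV : 0 < Fintype.card V) {u : MvPolynomial V k} (hu : u ∉ I)
    (hsoc : ∀ v, X v * u ∈ I) : IsGreatest R.pdSet (Fintype.card V - 1) := by
  refine ⟨R.mem_pdSet_iff.2 (R.nonempty_of_socle hu hsoc (by omega)), fun i hi => ?_⟩
  by_contra h
  exact not_isEmpty_iff.2 (R.mem_pdSet_iff.1 hi) (R.isEmpty_of_card_le hV (by omega))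

end MinFreeRes

section EdgeIdeal

variable {k V : Type} [Field k] [Fintype V] {E : Set (V × V)} {w : V → ℕ}

theorem prod_X_pow_notMem_edgeIdeal (hw : ∀ x, 2 ≤ w x) :
    ∏ x, (X x : MvPolynomial V k) ^ (w x - 1) ∉ edgeIdeal k E w := by
  classical
  have hI : edgeIdeal k E w = Ideal.span ((fun s => monomial s (1 : k)) ''
      ((fun e : V × V => Finsupp.single e.1 1 + Finsupp.single e.2 (w e.2)) '' E)) := by
    rw [edgeIdeal, Set.image_image]
    congr 1
    ext p
    simp only [Set.mem_ofPred_eq, Set.mem_image, X_pow_eq_monomial]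
    exact exists_congr fun e => and_congr_right fun _ => by rw [X, monomial_mul, one_mul, eq_comm]
  have hu : ∏ x, (X x : MvPolynomial V k) ^ (w x - 1) =
      monomial (Finsupp.equivFunOnFinite.symm fun x => w x - 1) 1 := by
    rw [monomial_eq, Finsupp.prod_fintype _ _ (by simp)]
    simp
  rw [hI, hu, mem_ideal_span_monomial_image]
  intro h
  obtain ⟨_, ⟨e, -, rfl⟩, hle⟩ := h (Finsupp.equivFunOnFinite.symm fun x => w x - 1) (by simp)
  have := hle e.2
  have := hw e.2
  simp at *
  omega

theorem X_mul_prod_X_pow_mem_edgeIdeal (hw : ∀ x, 2 ≤ w x) {x y : V} (hne : x ≠ y)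
    (hxy : (x, y) ∈ E) :
    X y * ∏ x, (X x : MvPolynomial V k) ^ (w x - 1) ∈ edgeIdeal k E w := by
  classical
  have hgen : (X x * X y ^ w y : MvPolynomial V k) ∈ edgeIdeal k E w :=
    Ideal.subset_span ⟨(x, y), hxy, rfl⟩
  refine Ideal.mem_of_dvd _ ?_ hgen
  rw [← Finset.mul_prod_erase _ _ (Finset.mem_univ y), ← mul_assoc, ← pow_succ',
    Nat.sub_add_cancel (by have := hw y; omega), mul_comm (X x)]
  refine mul_dvd_mul_left _ (dvd_trans (dvd_pow_self _ ?_)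
    (Finset.dvd_prod_of_mem _ (Finset.mem_erase.2 ⟨hne, Finset.mem_univ x⟩)))
  have := hw x
  omega

end EdgeIdeal

end WOG

/-- **Theorem (third class, regularity).**
`D` is a vertex-weighted oriented `m`-partite graph (`m ≥ 3`) of the third
class: the vertex set is partitioned into nonempty parts `V_1, …, V_m`
(encoded by `part : V → Fin m`), and, with the convention `V_{m+1} = V_1`,
its edges are exactly all pairs going from a vertex of `V_i` to a vertex of
`V_{i+1}` (`1 ≤ i ≤ m`), i.e. each `D_i` is a complete bipartite graph
oriented from `V_i` to `V_{i+1}`.  All weights are `≥ 2`.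
Then `pd I(D) = |V| - 1`. -/
theorem third_class_pd (k : Type) [Field k] (m : ℕ) (hm : 3 ≤ m)
    (V : Type) [Fintype V] (part : V → Fin m) (hpart : ∀ i : Fin m, ∃ x : V, part x = i)
    (E : Set (V × V))
    (hE : E = {p : V × V | (part p.2 : ℕ) = ((part p.1 : ℕ) + 1) % m})
    (w : V → ℕ) (hw2 : ∀ x : V, 2 ≤ w x)
    (R : WOG.MinFreeRes (WOG.edgeIdeal k E w)) :
    IsGreatest R.pdSet (Fintype.card V - 1) := by
  obtain ⟨x₀, -⟩ := hpart ⟨0, by omega⟩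
  refine R.isGreatest_pdSet_of_socle (Fintype.card_pos_iff.2 ⟨x₀⟩)
    (WOG.prod_X_pow_notMem_edgeIdeal hw2) fun y => ?_
  have hy := (part y).isLt
  obtain ⟨i, hi⟩ : ∃ i : Fin m, (part y : ℕ) = ((i : ℕ) + 1) % m := by
    rcases Nat.eq_zero_or_pos (part y : ℕ) with h | h
    · exact ⟨⟨m - 1, by omega⟩, by rw [h, Nat.sub_add_cancel (by omega), Nat.mod_self]⟩
    · exact ⟨⟨(part y : ℕ) - 1, by omega⟩, by
        rw [Nat.sub_add_cancel h, Nat.mod_eq_of_lt hy]⟩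
  obtain ⟨x, rfl⟩ := hpart i
  refine WOG.X_mul_prod_X_pow_mem_edgeIdeal hw2 (x := x) ?_ (by rw [hE]; exact hi)
  rintro rfl
  rcases Nat.lt_or_ge ((part x : ℕ) + 1) m with h | h
  · rw [Nat.mod_eq_of_lt h] at hi
    omega
  · rw [show (part x : ℕ) + 1 = m by omega, Nat.mod_self] at hi
    omega
end
end

section
/- Let m ≥ 3 be an integer and let D = (V,E,w) be a vertex-weighted oriented m-partite graph of the third class (with m parts). Assume w(x) ≥ 2 for all x ∈ V. Then depth(I(D)) = 1. -/
open MvPolynomial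

noncomputable section

namespace WOG

theorem edgeIdeal_eq_span_monomial (k : Type) [Field k] {V : Type} (E : Set (V × V))
    (w : V → ℕ) :
    edgeIdeal k E w = Ideal.span ((fun s => monomial s (1 : k)) ''
      ((fun e : V × V => Finsupp.single e.1 1 + Finsupp.single e.2 (w e.2)) '' E)) := by
  unfold edgeIdeal
  congr 1
  ext p
  simp only [Set.mem_ofPred_eq, Set.mem_image, exists_exists_and_eq_and]
  refine exists_congr fun e => and_congr_right fun _ => ?_
  rw [X_pow_eq_monomial, X, monomial_mul, one_mul, eq_comm]

/-- The socle monomial `∏ x ^ (w x - 1)` of `S ⧸ I(D)`. -/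
def socleMonomial (k : Type) [Field k] {V : Type} [Finite V] (w : V → ℕ) :
    MvPolynomial V k :=
  monomial (Finsupp.equivFunOnFinite.symm fun x => w x - 1) 1

theorem socleMonomial_notMem {k : Type} [Field k] {V : Type} [Finite V] {E : Set (V × V)}
    {w : V → ℕ} (hw : ∀ x, 1 ≤ w x) : socleMonomial k w ∉ edgeIdeal k E w := by
  classical
  rw [edgeIdeal_eq_span_monomial, mem_ideal_span_monomial_image]
  intro h
  obtain ⟨_, ⟨e, -, rfl⟩, hle⟩ := h (Finsupp.equivFunOnFinite.symm fun x => w x - 1)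
    (by simp [socleMonomial])
  have h2 := hle e.2
  have := hw e.2
  simp only [Finsupp.add_apply, Finsupp.single_eq_same,
    Finsupp.equivFunOnFinite_symm_apply_apply] at h2
  omega

theorem X_mul_socleMonomial_mem {k : Type} [Field k] {V : Type} [Finite V]
    {E : Set (V × V)} {w : V → ℕ} (hw : ∀ x, 2 ≤ w x) {x y : V} (hyx : y ≠ x)
    (he : (y, x) ∈ E) : X x * socleMonomial k w ∈ edgeIdeal k E w := by
  classical
  rw [edgeIdeal_eq_span_monomial, mem_ideal_span_monomial_image]
  intro s hs
  rw [socleMonomial, X, monomial_mul, one_mul, support_monomial, if_neg one_ne_zero,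
    Finset.mem_singleton] at hs
  subst hs
  refine ⟨_, ⟨(y, x), he, rfl⟩, fun z => ?_⟩
  have := hw z
  simp only [Finsupp.add_apply, Finsupp.equivFunOnFinite_symm_apply_apply,
    Finsupp.single_apply]
  split_ifs <;> subst_vars <;> first | omega | exact absurd rfl hyx

theorem mul_mem_of_mem_mIdeal {k V : Type} [Field k] {I : Ideal (MvPolynomial V k)}
    {f : MvPolynomial V k} (hf : ∀ x, X x * f ∈ I) {r : MvPolynomial V k}
    (hr : r ∈ mIdeal k V) : r * f ∈ I := by
  have : mIdeal k V ≤ Submodule.comap (LinearMap.mulRight (MvPolynomial V k) f) I := by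
    rw [mIdeal, Ideal.span_le]
    rintro _ ⟨x, rfl⟩
    exact hf x
  exact this hr

open scoped Pointwise in
/-- Multiplication by a variable is never surjective on a nonzero ideal. -/
theorem X_smul_top_ne_top {k V : Type} [Field k] {I : Ideal (MvPolynomial V k)} (hI : I ≠ ⊥)
    (x : V) : (⊤ : Submodule (MvPolynomial V k) I) ≠ (X x : MvPolynomial V k) • ⊤ := by
  intro h
  refine hI ((Submodule.eq_bot_iff _).2 fun p hp => ?_)
  induction hn : p.totalDegree using Nat.strong_induction_on generalizing p with
  | _ n ih =>
    by_contra h0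
    have hmem : (⟨p, hp⟩ : I) ∈ (X x : MvPolynomial V k) • (⊤ : Submodule _ I) :=
      h ▸ Submodule.mem_top
    obtain ⟨q, -, hq⟩ := (Submodule.mem_smul_pointwise_iff_exists _ _ _).1 hmem
    have hq' : X x * (q : MvPolynomial V k) = p := congrArg Subtype.val hq
    have hq0 : (q : MvPolynomial V k) ≠ 0 := by
      intro h'
      exact h0 (by rw [← hq', h', mul_zero])
    have hdeg := totalDegree_mul_of_isDomain (X_ne_zero (R := k) x) hq0
    rw [hq', totalDegree_X] at hdeg
    exact hq0 (ih _ (by omega) q q.2 rfl)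

theorem isRegular_singleton_X {k V : Type} [Field k] {I : Ideal (MvPolynomial V k)}
    (hI : I ≠ ⊥) (x : V) :
    RingTheory.Sequence.IsRegular I [(X x : MvPolynomial V k)] := by
  refine ⟨(RingTheory.Sequence.isWeaklyRegular_singleton_iff _ _).2 fun a b hab => ?_, ?_⟩
  · exact Subtype.ext (mul_left_cancel₀ (X_ne_zero (R := k) x) (congrArg Subtype.val hab))
  · rw [Ideal.ofList_singleton, Submodule.ideal_span_singleton_smul]
    exact X_smul_top_ne_top hI x

open scoped Pointwise in
/-- If `S ⧸ I` has a nonzero socle element, then no `I`-regular sequence in the maximal graded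
ideal is longer than `1`. -/
theorem length_le_one_of_isRegular {k V : Type} [Field k] {I : Ideal (MvPolynomial V k)}
    {f : MvPolynomial V k} (hfI : f ∉ I) (hf : ∀ r ∈ mIdeal k V, r * f ∈ I)
    {rs : List (MvPolynomial V k)} (hrs : ∀ r ∈ rs, r ∈ mIdeal k V)
    (hreg : RingTheory.Sequence.IsRegular I rs) : rs.length ≤ 1 := by
  match rs, hrs, hreg with
  | [], _, _ => simp
  | [_], _, _ => simp
  | a :: b :: t, hrs, hreg =>
    exfalso
    have ha := hf a (hrs a (by simp))
    have hb := hf b (hrs b (by simp))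
    obtain ⟨hareg, hrest⟩ := (RingTheory.Sequence.isWeaklyRegular_cons_iff _ _ _).1
      hreg.toIsWeaklyRegular
    obtain ⟨hbreg, -⟩ := (RingTheory.Sequence.isWeaklyRegular_cons_iff _ _ _).1 hrest
    have ha0 : a ≠ 0 := by
      rintro rfl
      refine hreg.top_ne_smul ?_
      have hsub : ∀ y : I, y = 0 := fun y => hareg (by simp)
      exact le_antisymm (fun y _ => hsub y ▸ Submodule.zero_mem _) le_top
    have hz : Submodule.Quotient.mk (p := a • (⊤ : Submodule (MvPolynomial V k) I))
        ⟨a * f, ha⟩ = 0 := by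
      apply hbreg
      change b • Submodule.Quotient.mk _ = b • 0
      rw [smul_zero, ← Submodule.Quotient.mk_smul, Submodule.Quotient.mk_eq_zero]
      refine (Submodule.mem_smul_pointwise_iff_exists _ _ _).2
        ⟨⟨b * f, hb⟩, Submodule.mem_top, Subtype.ext ?_⟩
      exact mul_left_comm a b f
    rw [Submodule.Quotient.mk_eq_zero] at hz
    obtain ⟨g, -, hg⟩ := (Submodule.mem_smul_pointwise_iff_exists _ _ _).1 hz
    have hg' : a * (g : MvPolynomial V k) = a * f := congrArg Subtype.val hg
    exact hfI (mul_left_cancel₀ ha0 hg' ▸ g.2)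

end WOG

/-- **Theorem (third class, regularity).**
`D` is a vertex-weighted oriented `m`-partite graph (`m ≥ 3`) of the third
class: the vertex set is partitioned into nonempty parts `V_1, …, V_m`
(encoded by `part : V → Fin m`), and, with the convention `V_{m+1} = V_1`,
its edges are exactly all pairs going from a vertex of `V_i` to a vertex of
`V_{i+1}` (`1 ≤ i ≤ m`), i.e. each `D_i` is a complete bipartite graph
oriented from `V_i` to `V_{i+1}`.  All weights are `≥ 2`.
Then `depth I(D) = 1`. -/
theorem third_class_depth (k : Type) [Field k] (m : ℕ) (hm : 3 ≤ m)
    (V : Type) [Fintype V] (part : V → Fin m) (hpart : ∀ i : Fin m, ∃ x : V, part x = i)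
    (E : Set (V × V))
    (hE : E = {p : V × V | (part p.2 : ℕ) = ((part p.1 : ℕ) + 1) % m})
    (w : V → ℕ) (hw2 : ∀ x : V, 2 ≤ w x)
    :
    IsGreatest (WOG.depthSet k (WOG.edgeIdeal k E w)) 1 := by
  have hedge : ∀ x : V, ∃ y, y ≠ x ∧ (y, x) ∈ E := by
    intro x
    obtain ⟨y, hy⟩ := hpart ⟨((part x : ℕ) + (m - 1)) % m, Nat.mod_lt _ (by omega)⟩
    have hlt := (part x).isLt
    have hxy : (part x : ℕ) = ((part y : ℕ) + 1) % m := by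
      rw [hy]
      change (part x : ℕ) = (((part x : ℕ) + (m - 1)) % m + 1) % m
      rw [Nat.mod_add_mod, show (part x : ℕ) + (m - 1) + 1 = part x + m by omega,
        Nat.add_mod_right, Nat.mod_eq_of_lt hlt]
    refine ⟨y, ?_, by rw [hE]; exact hxy⟩
    rintro rfl
    rcases Nat.lt_or_ge ((part y : ℕ) + 1) m with h | h
    · rw [Nat.mod_eq_of_lt h] at hxy
      omega
    · rw [show (part y : ℕ) + 1 = m by omega, Nat.mod_self] at hxy
      omega
  have hX : ∀ x : V, X x * WOG.socleMonomial k w ∈ WOG.edgeIdeal k E w := fun x =>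
    let ⟨_, hne, he⟩ := hedge x
    WOG.X_mul_socleMonomial_mem hw2 hne he
  have hf : WOG.socleMonomial k w ∉ WOG.edgeIdeal k E w :=
    WOG.socleMonomial_notMem fun x => one_le_two.trans (hw2 x)
  obtain ⟨x, -⟩ := hpart ⟨0, by omega⟩
  have hI : WOG.edgeIdeal k E w ≠ ⊥ := by
    intro h
    have hx := hX x
    rw [h, Ideal.mem_bot, mul_eq_zero] at hx
    rcases hx with hx | hx
    · exact X_ne_zero x hx
    · exact hf (hx ▸ Ideal.zero_mem _)
  constructor
  · refine ⟨[X x], rfl, ?_, WOG.isRegular_singleton_X hI x⟩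
    simpa [WOG.mIdeal] using
      Ideal.subset_span (Set.mem_range_self (f := (X : V → MvPolynomial V k)) x)
  · rintro n ⟨rs, rfl, hrs, hreg⟩
    exact WOG.length_le_one_of_isRegular hf
      (fun r hr => WOG.mul_mem_of_mem_mIdeal hX hr) hrs hreg
end
end
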